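/- arXiv:2212.00610 — 2 statements merged into one kernel-verified Lean document; each statement's English description precedes it below -/
import Mathlib

section
/- If G is a planar graph, then τ₂(G) ≤ ⌊√(4Δ(G)+50.25) + 31.1⌋. Furthermore, τ₂(G) ≤ max{41, ⌊√(4Δ(G)+50.25) + 11.5⌋}. -/
open SimpleGraph

/-- A `t`-tone `k`-coloring of a graph `G` assigns to each vertex a `t`-element subset of
`{1, …, k}` so that the labels of any two distinct vertices `v, w` share fewer than
`d(v,w)` colors (no constraint between different components, where the distance is infinite). -/
def IsTToneColoring {V : Type*} (G : SimpleGraph V) (t k : ℕ) (f : V → Finset ℕ) : Prop :=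
  (∀ v, f v ⊆ Finset.Icc 1 k) ∧ (∀ v, (f v).card = t) ∧
    ∀ ⦃v w : V⦄, v ≠ w → ((f v ∩ f w).card : ℕ∞) < G.edist v w

/-- The `t`-tone chromatic number: the least `k` admitting a `t`-tone `k`-coloring. -/
noncomputable def toneChromaticNumber {V : Type*} (G : SimpleGraph V) (t : ℕ) : ℕ :=
  sInf {k | ∃ f : V → Finset ℕ, IsTToneColoring G t k f}

/-- The maximum degree `Δ(G)` of a finite graph. -/
noncomputable def maxDeg {V : Type*} [Fintype V] (G : SimpleGraph V) : ℕ :=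
  Finset.univ.sup fun v => (G.neighborSet v).ncard

/-- `H` is a minor of `G`: disjoint connected branch sets, one for each vertex of `H`,
with an edge of `G` between the branch sets of any two adjacent vertices of `H`. -/
def IsMinor {W V : Type*} (H : SimpleGraph W) (G : SimpleGraph V) : Prop :=
  ∃ B : W → Set V,
    (∀ w, (G.induce (B w)).Connected) ∧
    (Pairwise fun w₁ w₂ => Disjoint (B w₁) (B w₂)) ∧
    ∀ ⦃w₁ w₂ : W⦄, H.Adj w₁ w₂ → ∃ u ∈ B w₁, ∃ v ∈ B w₂, G.Adj u v

/-- A graph is planar iff it has no `K₅` minor and no `K₃,₃` minor (Wagner's theorem). -/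
def IsPlanar {V : Type*} (G : SimpleGraph V) : Prop :=
  ¬ IsMinor (completeGraph (Fin 5)) G ∧ ¬ IsMinor (completeBipartiteGraph (Fin 3) (Fin 3)) G

section Minors

variable {V W : Type*} {G G' : SimpleGraph V} {H : SimpleGraph W}

theorem IsMinor.mono (hle : G' ≤ G) (h : IsMinor H G') : IsMinor H G := by
  obtain ⟨B, hc, hd, he⟩ := h
  refine ⟨B, fun w => (hc w).mono fun a b hab => hle hab, hd, fun w₁ w₂ hw => ?_⟩
  obtain ⟨u, hu, v, hv, huv⟩ := he hw
  exact ⟨u, hu, v, hv, hle huv⟩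

theorem IsMinor.of_injective_hom (f : W → V) (hf : Function.Injective f)
    (hadj : ∀ ⦃a b⦄, H.Adj a b → G.Adj (f a) (f b)) : IsMinor H G := by
  refine ⟨fun w => {f w}, fun w => ?_, fun a b hab => ?_, fun a b hab => ?_⟩
  · have : Nonempty ({f w} : Set V) := ⟨⟨f w, rfl⟩⟩
    exact ⟨fun a b => by rw [Subsingleton.elim a b]⟩
  · simpa using fun h => hab (hf h)
  · exact ⟨f a, rfl, f b, rfl, hadj hab⟩

theorem IsPlanar.mono (hle : G' ≤ G) (h : IsPlanar G) : IsPlanar G' :=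
  ⟨fun h5 => h.1 (h5.mono hle), fun h33 => h.2 (h33.mono hle)⟩

/-- Contract the edge `vx` into `x`, keeping `v` as an isolated vertex. -/
def contractInto (G : SimpleGraph V) (v x : V) : SimpleGraph V where
  Adj a b := a ≠ b ∧ a ≠ v ∧ b ≠ v ∧ (G.Adj a b ∨ (a = x ∧ G.Adj v b) ∨ (b = x ∧ G.Adj v a))
  symm := ⟨fun a b ⟨h₁, h₂, h₃, h₄⟩ => ⟨h₁.symm, h₃, h₂, by
    rcases h₄ with h | h | h
    · exact Or.inl h.symm
    · exact Or.inr (Or.inr h)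
    · exact Or.inr (Or.inl h)⟩⟩
  loopless := ⟨fun _ h => h.1 rfl⟩

theorem IsMinor.of_contractInto {v x : V} (hvx : G.Adj v x) (hH : ∀ w, ∃ w', H.Adj w w')
    (h : IsMinor H (contractInto G v x)) : IsMinor H G := by
  obtain ⟨B, hc, hd, he⟩ := h
  have hv : ∀ w, v ∉ B w := by
    intro w hvw
    obtain ⟨w', hw⟩ := hH w
    obtain ⟨u, hu, t, -, hut⟩ := he hw
    have hne : v ≠ u := fun h => hut.2.1 h.symm
    obtain ⟨p⟩ := (hc w).preconnected ⟨v, hvw⟩ ⟨u, hu⟩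
    cases p with
    | nil => exact hne rfl
    | cons hadj _ => exact hadj.2.1 rfl
  let B' : W → Set V := fun w => {a | a ∈ B w ∨ (a = v ∧ x ∈ B w)}
  have hsub : ∀ {w a}, a ∈ B w → a ∈ B' w := fun h => Or.inl h
  have hreach : ∀ w (a b : B w), ((contractInto G v x).induce (B w)).Reachable a b →
      (G.induce (B' w)).Reachable ⟨a, hsub a.2⟩ ⟨b, hsub b.2⟩ := by
    rintro w a b ⟨p⟩
    induction p with
    | nil => rfl
    | @cons a c b hac _ ih =>
      refine SimpleGraph.Reachable.trans ?_ ih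
      obtain ⟨-, -, -, h | ⟨hx, h⟩ | ⟨hx, h⟩⟩ := hac
      · exact SimpleGraph.Adj.reachable (G := G.induce (B' w)) h
      · have hxB : x ∈ B w := by rw [← hx]; exact a.2
        have h₁ : (G.induce (B' w)).Adj ⟨a, hsub a.2⟩ ⟨v, Or.inr ⟨rfl, hxB⟩⟩ := by
          change G.Adj a.1 v
          rw [show (a : V) = x from hx]
          exact hvx.symm
        have h₂ : (G.induce (B' w)).Adj ⟨v, Or.inr ⟨rfl, hxB⟩⟩ ⟨c, hsub c.2⟩ := h
        exact h₁.reachable.trans h₂.reachable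
      · have hxB : x ∈ B w := by rw [← hx]; exact c.2
        have h₁ : (G.induce (B' w)).Adj ⟨a, hsub a.2⟩ ⟨v, Or.inr ⟨rfl, hxB⟩⟩ := h.symm
        have h₂ : (G.induce (B' w)).Adj ⟨v, Or.inr ⟨rfl, hxB⟩⟩ ⟨c, hsub c.2⟩ := by
          change G.Adj v c.1
          rw [show (c : V) = x from hx]
          exact hvx
        exact h₁.reachable.trans h₂.reachable
  have hrep : ∀ w (a : B' w), ∃ b : B w, (G.induce (B' w)).Reachable a ⟨b, hsub b.2⟩ := by
    rintro w ⟨a, ha | ⟨rfl, hx⟩⟩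
    · exact ⟨⟨a, ha⟩, by rfl⟩
    · exact ⟨⟨x, hx⟩, SimpleGraph.Adj.reachable (G := G.induce (B' w)) hvx⟩
  refine ⟨B', fun w => ?_, fun a b hab => ?_, fun a b hab => ?_⟩
  · have : Nonempty (B' w) := ⟨⟨_, hsub (hc w).nonempty.some.2⟩⟩
    refine ⟨fun a b => ?_⟩
    obtain ⟨a', ha⟩ := hrep w a
    obtain ⟨b', hb⟩ := hrep w b
    exact ha.trans ((hreach w a' b' ((hc w).preconnected a' b')).trans hb.symm)
  · have hdab := Set.disjoint_left.1 (hd hab)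
    refine Set.disjoint_left.2 ?_
    rintro u (hu | ⟨h, hu⟩) (hu' | ⟨h', hu'⟩)
    exacts [hdab hu hu', hv _ (h' ▸ hu), hv _ (h ▸ hu'), hdab hu hu']
  · obtain ⟨u, hu, t, ht, -, -, -, h | ⟨rfl, h⟩ | ⟨rfl, h⟩⟩ := he hab
    · exact ⟨u, hsub hu, t, hsub ht, h⟩
    · exact ⟨v, Or.inr ⟨rfl, hu⟩, t, hsub ht, h⟩
    · exact ⟨u, hsub hu, v, Or.inr ⟨rfl, ht⟩, h.symm⟩

theorem IsPlanar.contract {v x : V} (hvx : G.Adj v x) (h : IsPlanar G) :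
    IsPlanar (contractInto G v x) := by
  refine ⟨fun h5 => h.1 (h5.of_contractInto hvx fun w => ?_),
    fun h33 => h.2 (h33.of_contractInto hvx fun w => ?_)⟩
  · exact ⟨w + 1, by revert w; decide⟩
  · rcases w with w | w
    · exact ⟨Sum.inr 0, by simp⟩
    · exact ⟨Sum.inl 0, by simp⟩

/-- A planar graph has no five pairwise adjacent vertices. -/
theorem IsPlanar.not_clique_five (h : IsPlanar G) {a b c d e : V} (hab : G.Adj a b)
    (hac : G.Adj a c) (had : G.Adj a d) (hae : G.Adj a e) (hbc : G.Adj b c) (hbd : G.Adj b d)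
    (hbe : G.Adj b e) (hcd : G.Adj c d) (hce : G.Adj c e) (hde : G.Adj d e) : False := by
  have hadj : ∀ i j : Fin 5, i ≠ j → G.Adj (![a, b, c, d, e] i) (![a, b, c, d, e] j) := by
    intro i j hij
    fin_cases i <;> fin_cases j <;>
      first
      | exact absurd rfl hij
      | (simp; first | assumption | (apply SimpleGraph.Adj.symm; assumption))
  refine h.1 (IsMinor.of_injective_hom ![a, b, c, d, e] (fun i j hij => ?_) fun i j hij =>
    hadj i j hij)
  by_contra hne
  exact (hadj i j hne).ne hij

/-- In a planar graph, no three vertices have three common neighbors. -/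
theorem IsPlanar.not_common_neighbors (h : IsPlanar G) {f g : Fin 3 → V}
    (hf : Function.Injective f) (hg : Function.Injective g) (hfg : ∀ i j, G.Adj (f i) (g j)) :
    False := by
  refine h.2 (IsMinor.of_injective_hom (Sum.elim f g) ?_ ?_)
  · exact hf.sumElim hg fun i j => (hfg i j).ne
  · rintro (i | i) (j | j) hij
    · simp at hij
    · exact hfg i j
    · exact (hfg j i).symm
    · simp at hij

end Minors

section EdgeBounds

open scoped Classical
open Finset

variable {V : Type*} {G : SimpleGraph V}

theorem contractInto_supported {A : Finset V} (hA : ∀ a b, G.Adj a b → a ∈ A) {v x : V}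
    (hvx : G.Adj v x) : ∀ a b, (contractInto G v x).Adj a b → a ∈ A.erase v := by
  rintro a b ⟨-, ha, -, h | ⟨rfl, -⟩ | ⟨-, h⟩⟩
  · exact Finset.mem_erase.2 ⟨ha, hA _ _ h⟩
  · exact Finset.mem_erase.2 ⟨ha, hA _ _ hvx.symm⟩
  · exact Finset.mem_erase.2 ⟨ha, hA _ _ h.symm⟩

variable [Fintype V]

theorem disjoint_image_incident {v x : V} {T : Finset V} (hT : ∀ w ∈ T, ¬ G.Adj x w) :
    Disjoint (G.edgeFinset \ G.incidenceFinset v) (T.image fun w => s(x, w)) := by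
  rw [Finset.disjoint_right]
  intro e he
  obtain ⟨w, hw, rfl⟩ := Finset.mem_image.1 he
  simp [hT w hw]

/-- Contracting an edge `vx` destroys only that edge and one edge for each common neighbor. -/
theorem card_edgeFinset_le_contractInto {v x : V} (hvx : G.Adj v x) :
    #G.edgeFinset ≤
      #(contractInto G v x).edgeFinset + 1 + #(G.neighborFinset v ∩ G.neighborFinset x) := by
  let T := (G.neighborFinset v \ G.neighborFinset x).erase x
  have hT : ∀ w ∈ T, w ≠ x ∧ G.Adj v w ∧ ¬ G.Adj x w := by
    intro w hw
    simpa [T] using hw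
  have hsub : (G.edgeFinset \ G.incidenceFinset v) ∪ (T.image fun w => s(x, w)) ⊆
      (contractInto G v x).edgeFinset := by
    intro e he
    rcases Finset.mem_union.1 he with he | he
    · induction e with
      | _ a b =>
        simp only [Finset.mem_sdiff, SimpleGraph.mem_edgeFinset, SimpleGraph.mem_edgeSet,
          SimpleGraph.mem_incidenceFinset,
          SimpleGraph.incidenceSet, Set.mem_ofPred_eq, Sym2.mem_iff, not_and, not_or] at he ⊢
        obtain ⟨hab, h⟩ := he
        exact ⟨hab.ne, Ne.symm (h hab).1, Ne.symm (h hab).2, Or.inl hab⟩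
    · obtain ⟨w, hw, rfl⟩ := Finset.mem_image.1 he
      obtain ⟨h₁, h₂, -⟩ := hT w hw
      simp only [SimpleGraph.mem_edgeFinset, SimpleGraph.mem_edgeSet]
      exact ⟨h₁.symm, hvx.ne', h₂.ne', Or.inr (Or.inl ⟨rfl, h₂⟩)⟩
  have hcard := Finset.card_le_card hsub
  rw [Finset.card_union_of_disjoint (disjoint_image_incident fun w hw => (hT w hw).2.2),
    Finset.card_image_of_injective _ fun a b hab => Sym2.congr_right.1 hab] at hcard
  have h₁ : #G.edgeFinset ≤ #(G.edgeFinset \ G.incidenceFinset v) + G.degree v := by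
    have := Finset.le_card_sdiff (G.incidenceFinset v) G.edgeFinset
    rw [G.card_incidenceFinset_eq_degree] at this
    omega
  have hxT : x ∈ G.neighborFinset v \ G.neighborFinset x := by simpa using hvx
  have h₂ : #T + 1 = #(G.neighborFinset v \ G.neighborFinset x) := Finset.card_erase_add_one hxT
  have h₃ := Finset.card_sdiff_add_card_inter (G.neighborFinset v) (G.neighborFinset x)
  rw [G.card_neighborFinset_eq_degree] at h₃
  omega

theorem sum_degrees_eq_of_supported {A : Finset V} (hA : ∀ a b, G.Adj a b → a ∈ A) :
    ∑ v ∈ A, G.degree v = 2 * #G.edgeFinset := by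
  rw [← G.sum_degrees_eq_twice_card_edges]
  refine Finset.sum_subset (Finset.subset_univ A) fun v _ hv => ?_
  rw [← G.card_neighborFinset_eq_degree, Finset.card_eq_zero, Finset.eq_empty_iff_forall_notMem]
  exact fun w hw => hv (hA v w (by simpa using hw))

theorem degree_lt_card_of_supported {A : Finset V} (hA : ∀ a b, G.Adj a b → a ∈ A) {v : V}
    (hv : v ∈ A) : G.degree v < #A := by
  rw [← G.card_neighborFinset_eq_degree]
  refine Finset.card_lt_card (Finset.ssubset_iff_subset_ne.2 ⟨fun w hw => ?_, fun h => ?_⟩)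
  · exact hA w v ((G.mem_neighborFinset v w).1 hw).symm
  · rw [← h] at hv
    simp at hv

/-- In a planar graph, a vertex of degree between one and five has an edge that lies in at most
two triangles. -/
theorem IsPlanar.exists_card_common_le_two (hG : IsPlanar G) {v : V} (h0 : 0 < G.degree v)
    (h5 : G.degree v ≤ 5) :
    ∃ u, G.Adj v u ∧ #(G.neighborFinset v ∩ G.neighborFinset u) ≤ 2 := by
  by_contra! hcon
  set N := G.neighborFinset v with hN
  have hcard : #N = G.degree v := G.card_neighborFinset_eq_degree v
  have hmem : ∀ {u}, u ∈ N ↔ G.Adj v u := by simp [hN]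
  have hfar : ∀ {u a b}, u ∈ N → a ∈ N → b ∈ N → a ≠ u → b ≠ u → ¬ G.Adj u a → ¬ G.Adj u b →
      a = b := by
    intro u a b hu ha hb hau hbu hna hnb
    by_contra hab
    have h := hcon u (hmem.1 hu)
    have hsub : N ∩ G.neighborFinset u ⊆ ((N.erase u).erase a).erase b := by
      intro w hw
      simp only [Finset.mem_inter, SimpleGraph.mem_neighborFinset] at hw
      simp only [Finset.mem_erase]
      exact ⟨fun h => hnb (h ▸ hw.2), fun h => hna (h ▸ hw.2), hw.2.ne', hw.1⟩
    have hle := Finset.card_le_card hsub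
    rw [Finset.card_erase_of_mem (by simp [hbu, Ne.symm hab, hb]),
      Finset.card_erase_of_mem (by simp [hau, ha]), Finset.card_erase_of_mem hu] at hle
    omega
  obtain ⟨u, hu⟩ := Finset.card_pos.1 (hcard ▸ h0)
  have h4 : 4 ≤ #N := by
    have h := hcon u (hmem.1 hu)
    have hsub : N ∩ G.neighborFinset u ⊆ N.erase u := by
      intro w hw
      simp only [Finset.mem_inter, SimpleGraph.mem_neighborFinset] at hw
      exact Finset.mem_erase.2 ⟨hw.2.ne', hw.1⟩
    have hle := Finset.card_le_card hsub
    rw [Finset.card_erase_of_mem hu] at hle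
    omega
  by_cases hclique : ∀ a ∈ N, ∀ b ∈ N, a ≠ b → G.Adj a b
  · obtain ⟨M, hMN, hM⟩ := Finset.exists_subset_card_eq h4
    obtain ⟨a, b, c, d, hab, hac, had, hbc, hbd, hcd, rfl⟩ := Finset.card_eq_four.1 hM
    have ha : a ∈ N := hMN (by simp)
    have hb : b ∈ N := hMN (by simp)
    have hc : c ∈ N := hMN (by simp)
    have hd : d ∈ N := hMN (by simp)
    exact hG.not_clique_five (hmem.1 ha) (hmem.1 hb) (hmem.1 hc) (hmem.1 hd)
      (hclique _ ha _ hb hab) (hclique _ ha _ hc hac) (hclique _ ha _ hd had)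
      (hclique _ hb _ hc hbc) (hclique _ hb _ hd hbd) (hclique _ hc _ hd hcd)
  · push Not at hclique
    obtain ⟨a, ha, b, hb, hab, hnab⟩ := hclique
    have h5' : #N = 5 := by
      have h := hcon a (hmem.1 ha)
      have hsub : N ∩ G.neighborFinset a ⊆ (N.erase a).erase b := by
        intro w hw
        simp only [Finset.mem_inter, SimpleGraph.mem_neighborFinset] at hw
        simp only [Finset.mem_erase]
        exact ⟨fun h => hnab (h ▸ hw.2), hw.2.ne', hw.1⟩
      have hle := Finset.card_le_card hsub
      rw [Finset.card_erase_of_mem (by simp [hab.symm, hb]), Finset.card_erase_of_mem ha] at hle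
      omega
    have h3 : #((N.erase a).erase b) = 3 := by
      rw [Finset.card_erase_of_mem (by simp [hab.symm, hb]), Finset.card_erase_of_mem ha, h5']
    obtain ⟨c, d, e, hcd, hce, hde, hcde⟩ := Finset.card_eq_three.1 h3
    have hrest : ∀ w ∈ ({c, d, e} : Finset V), w ∈ N ∧ w ≠ a ∧ w ≠ b ∧ G.Adj a w ∧
        G.Adj b w := by
      intro w hw
      rw [← hcde] at hw
      simp only [Finset.mem_erase] at hw
      obtain ⟨hwb, hwa, hw⟩ := hw
      refine ⟨hw, hwa, hwb, ?_, ?_⟩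
      · by_contra h
        exact hwb (hfar ha hw hb hwa hab.symm h hnab)
      · by_contra h
        exact hwa (hfar hb hw ha hwb hab h fun h => hnab h.symm)
    have hmain : ∀ x ∈ ({c, d, e} : Finset V), ∀ y ∈ ({c, d, e} : Finset V),
        ∀ z ∈ ({c, d, e} : Finset V), x ≠ y → x ≠ z → G.Adj y z → False := by
      intro x hx y hy z hz hxy hxz hyz
      obtain ⟨hxN, hxa, hxb, hax, hbx⟩ := hrest x hx
      obtain ⟨hyN, hya, hyb, hay, hby⟩ := hrest y hy
      obtain ⟨hzN, hza, hzb, haz, hbz⟩ := hrest z hz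
      have hvx := hmem.1 hxN
      have hva := hmem.1 ha
      have hvb := hmem.1 hb
      have hvy := hmem.1 hyN
      have hvz := hmem.1 hzN
      refine (hG.contract hax.symm).not_clique_five (a := v) (b := a) (c := b) (d := y)
        (e := z) ⟨hva.ne, hvx.ne, hxa.symm, Or.inl hva⟩ ⟨hvb.ne, hvx.ne, hxb.symm, Or.inl hvb⟩
        ⟨hvy.ne, hvx.ne, hxy.symm, Or.inl hvy⟩ ⟨hvz.ne, hvx.ne, hxz.symm, Or.inl hvz⟩
        ⟨hab, hxa.symm, hxb.symm, Or.inr (Or.inl ⟨rfl, hbx.symm⟩)⟩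
        ⟨hya.symm, hxa.symm, hxy.symm, Or.inl hay⟩ ⟨hza.symm, hxa.symm, hxz.symm, Or.inl haz⟩
        ⟨hyb.symm, hxb.symm, hxy.symm, Or.inl hby⟩ ⟨hzb.symm, hxb.symm, hxz.symm, Or.inl hbz⟩
        ⟨hyz.ne, hxy.symm, hxz.symm, Or.inl hyz⟩
    by_cases h₁ : G.Adj d e
    · exact hmain c (by simp) d (by simp) e (by simp) hcd hce h₁
    · by_cases h₂ : G.Adj d c
      · exact hmain e (by simp) d (by simp) c (by simp) hde.symm hce.symm h₂
      · exact hce (hfar (hrest d (by simp)).1 (hrest c (by simp)).1 (hrest e (by simp)).1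
          hcd hde.symm h₂ h₁)

theorem exists_le_card_edgeFinset_eq {m : ℕ} (hm : m ≤ #G.edgeFinset) :
    ∃ F ≤ G, #F.edgeFinset = m := by
  obtain ⟨s, hs, rfl⟩ := Finset.exists_subset_card_eq hm
  have hs' : ∀ e ∈ s, e ∈ G.edgeSet := fun e he => SimpleGraph.mem_edgeFinset.1 (hs he)
  refine ⟨SimpleGraph.fromEdgeSet (s : Set (Sym2 V)), fun a b hab => ?_, ?_⟩
  · exact hs' _ (by simpa using hab.1)
  · congr 1
    ext e
    simpa using fun he => G.not_isDiag_of_mem_edgeSet (hs' e he)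

/-- A planar graph on `n ≥ 3` vertices has at most `3 n - 6` edges. -/
theorem IsPlanar.card_edgeFinset_add_six_le (hG : IsPlanar G) (A : Finset V)
    (hA : ∀ a b, G.Adj a b → a ∈ A) (h3 : 3 ≤ #A) : #G.edgeFinset + 6 ≤ 3 * #A := by
  induction hn : #A generalizing G A with
  | zero => omega
  | succ n ih =>
  by_contra! hlt
  obtain ⟨F, hFG, hF⟩ : ∃ F ≤ G, #F.edgeFinset = 3 * #A - 5 :=
    exists_le_card_edgeFinset_eq (by omega)
  replace hG := hG.mono hFG
  replace hA : ∀ a b, F.Adj a b → a ∈ A := fun a b hab => hA a b (hFG hab)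
  have hsum := sum_degrees_eq_of_supported hA
  rcases h3.eq_or_lt with h3 | h4
  · have hle : ∑ v ∈ A, F.degree v ≤ ∑ v ∈ A, 2 := Finset.sum_le_sum fun v hv => by
      have := degree_lt_card_of_supported hA hv
      omega
    simp at hle
    omega
  obtain ⟨v, hv, hdeg⟩ : ∃ v ∈ A, F.degree v < 6 := by
    refine Finset.exists_lt_of_sum_lt (s := A) (f := fun v => F.degree v) (g := fun _ => 6) ?_
    simp
    omega
  have herase : #(A.erase v) + 1 = #A := Finset.card_erase_add_one hv
  rcases Nat.eq_zero_or_pos (F.degree v) with h0 | h0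
  · have := ih hG (A.erase v) (fun a b hab => Finset.mem_erase.2 ⟨?_, hA a b hab⟩)
      (by omega) (by omega)
    · omega
    · rintro rfl
      exact (F.degree_pos_iff_exists_adj a).2 ⟨b, hab⟩ |>.ne' h0
  · obtain ⟨u, hvu, hu⟩ := hG.exists_card_common_le_two h0 (by omega)
    have hc := card_edgeFinset_le_contractInto hvu
    have := ih (hG.contract hvu) (A.erase v) (contractInto_supported hA hvu) (by omega)
      (by omega)
    omega

theorem IsPlanar.card_edgeFinset_le (hG : IsPlanar G) (A : Finset V)
    (hA : ∀ a b, G.Adj a b → a ∈ A) : #G.edgeFinset ≤ 3 * #A := by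
  rcases le_or_gt 3 #A with h | h
  · have := hG.card_edgeFinset_add_six_le A hA h
    omega
  · have hsum := sum_degrees_eq_of_supported hA
    have hle : ∑ v ∈ A, G.degree v ≤ ∑ v ∈ A, 2 := Finset.sum_le_sum fun v hv => by
      have := degree_lt_card_of_supported hA hv
      omega
    simp at hle
    omega

end EdgeBounds

section CubicVertices

open scoped Classical
open Finset

variable {V : Type*} {G : SimpleGraph V}

/-- The edges of `G` with both ends in `S`, as a graph on all vertices. -/
def restrictTo (G : SimpleGraph V) (S : Finset V) : SimpleGraph V where
  Adj a b := G.Adj a b ∧ a ∈ S ∧ b ∈ S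
  symm := ⟨fun _ _ ⟨h, ha, hb⟩ => ⟨h.symm, hb, ha⟩⟩
  loopless := ⟨fun _ h => G.irrefl h.1⟩

theorem restrictTo_le (S : Finset V) : restrictTo G S ≤ G := fun _ _ h => h.1

variable [Fintype V]

theorem IsPlanar.card_filter_neighborFinset_eq_le_two (hG : IsPlanar G) (X : Finset V)
    {M : Finset V} (hM : #M = 3) : #{x ∈ X | G.neighborFinset x = M} ≤ 2 := by
  by_contra! hcon
  obtain ⟨Y, hY, hY3⟩ := Finset.exists_subset_card_eq (show 3 ≤ _ from hcon)
  let eM := M.equivFinOfCardEq hM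
  let eY := Y.equivFinOfCardEq hY3
  refine hG.not_common_neighbors (f := fun i => (eY.symm i : V)) (g := fun i => (eM.symm i : V))
    (Subtype.val_injective.comp eY.symm.injective)
    (Subtype.val_injective.comp eM.symm.injective) fun i j => ?_
  have h := (Finset.mem_filter.1 (hY (eY.symm i).2)).2
  rw [← SimpleGraph.mem_neighborFinset, h]
  exact (eM.symm j).2

/-- If every vertex of `X` has exactly three neighbors, which lie in `S` and are pairwise
adjacent, then `X` is at most a constant factor larger than `S`. -/
theorem IsPlanar.card_le_of_neighbors_clique (hG : IsPlanar G) (S X : Finset V)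
    (hX : ∀ x ∈ X, G.neighborFinset x ⊆ S ∧ #(G.neighborFinset x) = 3)
    (hcl : ∀ x ∈ X, ∀ a b, G.Adj x a → G.Adj x b → a ≠ b → G.Adj a b) : #X ≤ 30 * #S := by
  induction hn : #S generalizing S X with
  | zero =>
    rw [Finset.card_eq_zero] at hn
    suffices X = ∅ by simp [this]
    refine Finset.eq_empty_of_forall_notMem fun x hx => ?_
    obtain ⟨h₁, h₂⟩ := hX x hx
    have := Finset.card_le_card h₁
    simp [hn] at this
    simp [this] at h₂
  | succ n ih =>
    have hsupp : ∀ a b, (restrictTo G S).Adj a b → a ∈ S := fun a b h => h.2.1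
    have hle := (hG.mono (restrictTo_le S)).card_edgeFinset_le S hsupp
    have hsum := sum_degrees_eq_of_supported hsupp
    obtain ⟨s, hs, hdeg⟩ : ∃ s ∈ S, (restrictTo G S).degree s < 7 := by
      refine Finset.exists_lt_of_sum_lt (s := S) (f := fun v => (restrictTo G S).degree v)
        (g := fun _ => 7) ?_
      simp
      omega
    have hfew : #{x ∈ X | G.Adj x s} ≤ 30 := by
      have hmaps : ∀ x ∈ X.filter fun x => G.Adj x s, (G.neighborFinset x).erase s ∈
          ((restrictTo G S).neighborFinset s).powersetCard 2 := by
        intro x hx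
        obtain ⟨hx, hxs⟩ := Finset.mem_filter.1 hx
        rw [Finset.mem_powersetCard]
        refine ⟨fun a ha => ?_, ?_⟩
        · simp only [Finset.mem_erase, SimpleGraph.mem_neighborFinset] at ha ⊢
          exact ⟨hcl x hx s a hxs ha.2 ha.1.symm, hs, (hX x hx).1 (by simpa using ha.2)⟩
        · rw [Finset.card_erase_of_mem (by simpa using hxs), (hX x hx).2]
      have h := Finset.card_le_mul_card_image_of_maps_to hmaps 2 fun M hM => by
        rcases (X.filter fun x => G.Adj x s).filter
          (fun x => (G.neighborFinset x).erase s = M) |>.eq_empty_or_nonempty with h0 | ⟨y, hy⟩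
        · simp [h0]
        · simp only [Finset.mem_filter] at hy
          obtain ⟨⟨hyX, hys⟩, rfl⟩ := hy
          refine le_trans (Finset.card_le_card fun x hx => ?_)
            (hG.card_filter_neighborFinset_eq_le_two X (hX y hyX).2)
          simp only [Finset.mem_filter] at hx ⊢
          obtain ⟨⟨hxX, hxs⟩, h⟩ := hx
          refine ⟨hxX, ?_⟩
          rw [← Finset.insert_erase (show s ∈ G.neighborFinset x by simpa using hxs), h,
            Finset.insert_erase (show s ∈ G.neighborFinset y by simpa using hys)]
      rw [Finset.card_powersetCard, SimpleGraph.card_neighborFinset_eq_degree] at h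
      have hch : ((restrictTo G S).degree s).choose 2 ≤ Nat.choose 6 2 :=
        Nat.choose_le_choose 2 (by omega)
      have : Nat.choose 6 2 = 15 := rfl
      omega
    have hsplit := Finset.card_filter_add_card_filter_not (s := X) fun x => G.Adj x s
    have := ih (S.erase s) (X.filter fun x => ¬ G.Adj x s)
      (fun x hx => by
        obtain ⟨hxX, hxs⟩ := Finset.mem_filter.1 hx
        refine ⟨fun a ha => Finset.mem_erase.2 ⟨?_, (hX x hxX).1 ha⟩, (hX x hxX).2⟩
        rintro rfl
        exact hxs (by simpa using ha))
      (fun x hx => hcl x (Finset.mem_filter.1 hx).1)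
      (by rw [Finset.card_erase_of_mem hs]; omega)
    omega

/-- The number of vertices of degree three all of whose neighbors lie in `S` is at most a
constant factor times the size of `S`. -/
theorem IsPlanar.card_add_card_edgeFinset_le (hG : IsPlanar G) (S X : Finset V)
    (hdisj : Disjoint X S)
    (hX : ∀ x ∈ X, G.neighborFinset x ⊆ S ∧ #(G.neighborFinset x) = 3) :
    #X + #(restrictTo G S).edgeFinset ≤ 33 * #S := by
  induction hn : #X generalizing G X with
  | zero =>
    have := (hG.mono (restrictTo_le S)).card_edgeFinset_le S fun a b h => h.2.1
    omega
  | succ n ih =>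
    by_cases hcl : ∀ x ∈ X, ∀ a b, G.Adj x a → G.Adj x b → a ≠ b → G.Adj a b
    · have h₁ := (hG.mono (restrictTo_le S)).card_edgeFinset_le S fun a b h => h.2.1
      have h₂ := hG.card_le_of_neighbors_clique S X hX hcl
      omega
    · push Not at hcl
      obtain ⟨x, hx, a, b, hxa, hxb, hab, hnab⟩ := hcl
      have hXS : ∀ {y}, y ∈ X → y ∉ S := fun hy => Finset.disjoint_left.1 hdisj hy
      have hxS : ∀ {y c}, y ∈ X → G.Adj y c → c ∈ S := fun hy h =>
        (hX _ hy).1 (by simpa using h)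
      have hmono : ∀ c d, (restrictTo G S).Adj c d →
          (restrictTo (contractInto G x a) S).Adj c d := fun c d ⟨h, hc, hd⟩ =>
        ⟨⟨h.ne, fun h => hXS hx (h ▸ hc), fun h => hXS hx (h ▸ hd), Or.inl h⟩, hc, hd⟩
      have hlt : #(restrictTo G S).edgeFinset <
          #(restrictTo (contractInto G x a) S).edgeFinset := by
        refine Finset.card_lt_card (SimpleGraph.edgeFinset_ssubset_edgeFinset.2
          (lt_of_le_of_ne (fun c d => hmono c d) fun h => hnab ?_))
        have : (restrictTo (contractInto G x a) S).Adj a b :=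
          ⟨⟨hab, hxa.ne', hxb.ne', Or.inr (Or.inl ⟨rfl, hxb⟩)⟩, hxS hx hxa, hxS hx hxb⟩
        rw [← h] at this
        exact this.1
      have hnbr : ∀ y ∈ X.erase x, (contractInto G x a).neighborFinset y =
          G.neighborFinset y := by
        intro y hy
        obtain ⟨hyx, hy⟩ := Finset.mem_erase.1 hy
        ext c
        simp only [SimpleGraph.mem_neighborFinset]
        constructor
        · rintro ⟨-, -, -, h | ⟨rfl, -⟩ | ⟨-, h⟩⟩
          · exact h
          · exact absurd (hxS hx hxa) (hXS hy)
          · exact absurd (hxS hx h) (hXS hy)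
        · intro h
          exact ⟨h.ne, hyx, fun hc => hXS hx (hc ▸ hxS hy h), Or.inl h⟩
      have := ih (hG.contract hxa) (X.erase x)
        (hdisj.mono_left (Finset.erase_subset x X))
        (fun y hy => by rw [hnbr y hy]; exact hX y (Finset.mem_of_mem_erase hy))
        (by rw [Finset.card_erase_of_mem hx]; omega)
      omega

end CubicVertices

section Discharging

open scoped Classical
open Finset

variable {V : Type*} [Fintype V] {G : SimpleGraph V}

/-- The charge sent by a vertex of degree `d` to an adjacent vertex of degree `e`. -/
def transfer (d e : ℕ) : ℤ :=
  if e ≤ 4 then (if 18 ≤ d then 2 else 0) else if e = 5 then (if 11 ≤ d then 1 else 0) else 0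

theorem transfer_nonneg (d e : ℕ) : 0 ≤ transfer d e := by
  unfold transfer
  split_ifs <;> simp

theorem transfer_le (d e : ℕ) :
    transfer d e ≤ if 18 ≤ d then 2 else if 11 ≤ d then 1 else 0 := by
  unfold transfer
  split_ifs <;> omega

/-- In a planar graph with an edge there is a vertex of degree between one and five that has
at most two neighbors of large degree. -/
theorem IsPlanar.exists_light_vertex (hG : IsPlanar G) {v₀ w₀ : V} (h₀ : G.Adj v₀ w₀) :
    ∃ v, (0 < G.degree v ∧ G.degree v ≤ 2) ∨
      (G.degree v = 3 ∧ #{u ∈ G.neighborFinset v | 117 ≤ G.degree u} ≤ 2) ∨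
      (G.degree v = 4 ∧ #{u ∈ G.neighborFinset v | 18 ≤ G.degree u} ≤ 2) ∨
      (G.degree v = 5 ∧ #{u ∈ G.neighborFinset v | 11 ≤ G.degree u} ≤ 2) := by
  by_contra! hcon
  let A : Finset V := {v | 0 < G.degree v}
  have hAmem : ∀ {v}, v ∈ A ↔ 0 < G.degree v := by simp [A]
  have hA : ∀ a b, G.Adj a b → a ∈ A := fun a b h =>
    hAmem.2 ((G.degree_pos_iff_exists_adj a).2 ⟨b, h⟩)
  have hdeg3 : ∀ v ∈ A, 3 ≤ G.degree v := fun v hv => (hcon v).1 (hAmem.1 hv)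
  have hv₀ : v₀ ∈ A := hA _ _ h₀
  have h4 : 3 ≤ #A := by
    have := degree_lt_card_of_supported hA hv₀
    have := hdeg3 _ hv₀
    omega
  have hedges := hG.card_edgeFinset_add_six_le A hA h4
  have hsum := sum_degrees_eq_of_supported hA
  let S : Finset V := {v | 117 ≤ G.degree v}
  let X : Finset V := {v | G.degree v = 3}
  have hX : ∀ x ∈ X, G.neighborFinset x ⊆ S ∧ #(G.neighborFinset x) = 3 := by
    intro x hx
    have hx3 : G.degree x = 3 := by simpa [X] using hx
    have h3 : #(G.neighborFinset x) = 3 := by rw [G.card_neighborFinset_eq_degree, hx3]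
    refine ⟨?_, h3⟩
    have h := (hcon x).2.1 hx3
    have heq := Finset.eq_of_subset_of_card_le
      (Finset.filter_subset (fun u => 117 ≤ G.degree u) (G.neighborFinset x)) (by omega)
    rw [← heq]
    intro u hu
    simpa [S] using (Finset.mem_filter.1 hu).2
  have hXS : #X ≤ 33 * #S := by
    have := hG.card_add_card_edgeFinset_le S X (Finset.disjoint_left.2 fun v h₁ h₂ => by
      simp [X, S] at h₁ h₂
      omega) hX
    omega
  have hSA : S ⊆ A := fun v hv => hAmem.2 (by simp [S] at hv; omega)
  have hXA : X ⊆ A := fun v hv => hAmem.2 (by simp [X] at hv; omega)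
  let r : V → V → ℤ := fun u v => if G.Adj u v then transfer (G.degree u) (G.degree v) else 0
  have hr : ∀ u v, 0 ≤ r u v := fun u v => by
    simp only [r]
    split_ifs
    exacts [transfer_nonneg _ _, le_rfl]
  have hfinal : ∀ v ∈ A, (if v ∈ S then 99 else 0) - (if v ∈ X then 3 else 0) ≤
      3 * ((G.degree v : ℤ) - 6) + ∑ u ∈ A, r u v - ∑ u ∈ A, r v u := by
    intro v hv
    have hNA : G.neighborFinset v ⊆ A := fun u hu => hA u v (by simpa using hu : G.Adj v u).symm
    have hin : ∀ t c : ℕ, (∀ u, G.Adj u v → t ≤ G.degree u → (c : ℤ) ≤ r u v) →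
        3 ≤ #{u ∈ G.neighborFinset v | t ≤ G.degree u} → (3 * c : ℤ) ≤ ∑ u ∈ A, r u v := by
      intro t c h h3
      calc (3 * c : ℤ) ≤ #{u ∈ G.neighborFinset v | t ≤ G.degree u} * c := by
            exact_mod_cast Nat.mul_le_mul_right c h3
        _ = ∑ u ∈ G.neighborFinset v with t ≤ G.degree u, (c : ℤ) := by simp
        _ ≤ ∑ u ∈ G.neighborFinset v with t ≤ G.degree u, r u v :=
            Finset.sum_le_sum fun u hu => by
              simp only [Finset.mem_filter, SimpleGraph.mem_neighborFinset] at hu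
              exact h u hu.1.symm hu.2
        _ ≤ ∑ u ∈ A, r u v := Finset.sum_le_sum_of_subset_of_nonneg
            ((Finset.filter_subset _ _).trans hNA) fun u _ _ => hr u v
    have hin0 : 0 ≤ ∑ u ∈ A, r u v := Finset.sum_nonneg fun u _ => hr u v
    have hout : ∑ u ∈ A, r v u ≤
        G.degree v * if 18 ≤ G.degree v then 2 else if 11 ≤ G.degree v then 1 else 0 := by
      calc ∑ u ∈ A, r v u = ∑ u ∈ G.neighborFinset v, r v u := by
            refine (Finset.sum_subset hNA fun u _ hu => ?_).symm
            simp only [SimpleGraph.mem_neighborFinset] at hu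
            simp [r, hu]
        _ ≤ ∑ u ∈ G.neighborFinset v,
            (if 18 ≤ G.degree v then 2 else if 11 ≤ G.degree v then 1 else 0) := by
            refine Finset.sum_le_sum fun u hu => ?_
            simp only [SimpleGraph.mem_neighborFinset] at hu
            simp only [r, hu, if_true]
            exact transfer_le _ _
        _ = _ := by simp
    have hvS : v ∈ S ↔ 117 ≤ G.degree v := by simp [S]
    have hvX : v ∈ X ↔ G.degree v = 3 := by simp [X]
    have h3 := hdeg3 v hv
    obtain ⟨-, c3, c4, c5⟩ := hcon v
    simp only [hvS, hvX]
    rcases (by omega : G.degree v = 3 ∨ G.degree v = 4 ∨ G.degree v = 5 ∨ 6 ≤ G.degree v)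
      with h | h | h | h
    · have := hin 117 2 (fun u hu hd => by
        simp only [r, hu, if_true, transfer, h]
        simp [show 18 ≤ G.degree u by omega]) (c3 h)
      simp [h] at hout ⊢
      push_cast at this
      linarith
    · have := hin 18 2 (fun u hu hd => by
        simp only [r, hu, if_true, transfer, h]
        simp [hd]) (c4 h)
      simp [h] at hout ⊢
      push_cast at this
      linarith
    · have := hin 11 1 (fun u hu hd => by
        simp only [r, hu, if_true, transfer, h]
        simp [hd]) (c5 h)
      simp [h] at hout ⊢
      push_cast at this
      linarith
    · have h' : G.degree v ≠ 3 := by omega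
      split_ifs at hout ⊢ <;> omega
  have htotal := Finset.sum_le_sum hfinal
  have hcomm : ∑ v ∈ A, ∑ u ∈ A, r u v = ∑ v ∈ A, ∑ u ∈ A, r v u := Finset.sum_comm
  have hS : ∑ v ∈ A, (if v ∈ S then (99 : ℤ) else 0) = 99 * #S := by
    rw [← Finset.sum_filter, Finset.filter_mem_eq_inter, Finset.inter_eq_right.2 hSA]
    simp [mul_comm]
  have hX' : ∑ v ∈ A, (if v ∈ X then (3 : ℤ) else 0) = 3 * #X := by
    rw [← Finset.sum_filter, Finset.filter_mem_eq_inter, Finset.inter_eq_right.2 hXA]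
    simp [mul_comm]
  simp only [Finset.sum_sub_distrib, Finset.sum_add_distrib, ← Finset.mul_sum, hS, hX'] at htotal
  simp only [hcomm, Finset.sum_const, nsmul_eq_mul] at htotal
  have hsum' : ∑ v ∈ A, (G.degree v : ℤ) = 2 * #G.edgeFinset := by exact_mod_cast hsum
  rw [hsum'] at htotal
  omega

end Discharging

section Coloring

open scoped Classical
open Finset

variable {V : Type*} {G : SimpleGraph V}

/-- If `G` has distinct labels at distance two and disjoint labels at distance one, then the
coloring is `2`-tone. -/
theorem isTToneColoring_two {k : ℕ} {f : V → Finset ℕ} (hk : ∀ v, f v ⊆ Finset.Icc 1 k)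
    (h2 : ∀ v, #(f v) = 2) (hadj : ∀ u w, G.Adj u w → Disjoint (f u) (f w))
    (hne : ∀ u w z, u ≠ w → G.Adj u z → G.Adj z w → f u ≠ f w) : IsTToneColoring G 2 k f := by
  refine ⟨hk, h2, fun v w hvw => ?_⟩
  by_contra! hle
  have htop : G.edist v w ≠ ⊤ := ne_top_of_le_ne_top (ENat.natCast_ne_top _) hle
  obtain ⟨p, hp⟩ := SimpleGraph.exists_walk_of_edist_ne_top htop
  rw [← hp, Nat.cast_le] at hle
  have hle2 : #(f v ∩ f w) ≤ 2 := (Finset.card_le_card Finset.inter_subset_left).trans (h2 v).le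
  match p, hle with
  | .nil, _ => exact hvw rfl
  | .cons h .nil, hle =>
    rw [Finset.disjoint_iff_inter_eq_empty.1 (hadj _ _ h)] at hle
    simp at hle
  | .cons h (.cons h' .nil), hle =>
    have h2' : #(f v ∩ f w) = 2 := le_antisymm hle2 (by simpa using hle)
    refine hne _ _ _ hvw h h' ?_
    rw [← Finset.eq_of_subset_of_card_le (Finset.inter_subset_left (s₁ := f v) (s₂ := f w))
      (by rw [h2 v, h2'])]
    exact Finset.eq_of_subset_of_card_le Finset.inter_subset_right (by rw [h2 w, h2'])
  | .cons h (.cons h' (.cons h'' p)), hle =>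
    simp only [SimpleGraph.Walk.length_cons] at hle
    omega

/-- A label that is disjoint from the labels on `N` and differs from those on `M`. -/
theorem exists_label {k : ℕ} {f : V → Finset ℕ} (h2 : ∀ v, #(f v) = 2) (N M : Finset V)
    (hM : #M < (k - 2 * #N).choose 2) :
    ∃ P ⊆ Finset.Icc 1 k, #P = 2 ∧ (∀ u ∈ N, Disjoint P (f u)) ∧ ∀ w ∈ M, P ≠ f w := by
  have hpal : k - 2 * #N ≤ #(Finset.Icc 1 k \ N.biUnion f) := by
    have h₁ := Finset.le_card_sdiff (N.biUnion f) (Finset.Icc 1 k)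
    have h₂ : #(N.biUnion f) ≤ #N * 2 := Finset.card_biUnion_le_card_mul _ _ _ fun v _ => (h2 v).le
    rw [Nat.card_Icc] at h₁
    omega
  obtain ⟨P, hP, hPM⟩ := Finset.exists_mem_notMem_of_card_lt_card
    (s := M.image f) (t := (Finset.Icc 1 k \ N.biUnion f).powersetCard 2) (by
      rw [Finset.card_powersetCard]
      exact Finset.card_image_le.trans_lt (hM.trans_le (Nat.choose_le_choose 2 hpal)))
  obtain ⟨hsub, hcard⟩ := Finset.mem_powersetCard.1 hP
  refine ⟨P, hsub.trans Finset.sdiff_subset, hcard, fun u hu => ?_, fun w hw h => ?_⟩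
  · rw [Finset.disjoint_left]
    intro c hc hcu
    exact (Finset.mem_sdiff.1 (hsub hc)).2 (Finset.mem_biUnion.2 ⟨u, hu, hcu⟩)
  · exact hPM (Finset.mem_image.2 ⟨w, hw, h.symm⟩)

variable [Fintype V]

/-- The vertices other than `v` that have a common neighbor with `v`. -/
noncomputable def secondNeighbors (G : SimpleGraph V) (v : V) : Finset V :=
  (G.neighborFinset v).biUnion fun u => (G.neighborFinset u).erase v

theorem mem_secondNeighbors {v z w : V} (hvz : G.Adj v z) (hzw : G.Adj z w) (h : w ≠ v) :
    w ∈ secondNeighbors G v :=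
  Finset.mem_biUnion.2 ⟨z, by simpa using hvz, by simpa using ⟨h, hzw⟩⟩

theorem card_secondNeighbors_le (v : V) :
    #(secondNeighbors G v) ≤ ∑ u ∈ G.neighborFinset v, (G.degree u - 1) := by
  refine Finset.card_biUnion_le.trans (Finset.sum_le_sum fun u hu => ?_)
  rw [Finset.card_erase_of_mem (by simpa using ((G.mem_neighborFinset v u).1 hu).symm),
    G.card_neighborFinset_eq_degree]

/-- Greedy `2`-tone coloring. -/
theorem exists_twoTone_of_degree_le {d k : ℕ} (hd : ∀ v, G.degree v ≤ d)
    (hk : d * (d - 1) < (k - 2 * d).choose 2) : ∃ f, IsTToneColoring G 2 k f := by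
  have hk2 : 2 ≤ k := by
    by_contra! h
    rw [Nat.choose_eq_zero_of_lt (by omega)] at hk
    omega
  suffices h : ∀ A : Finset V, ∃ f : V → Finset ℕ, (∀ v, f v ⊆ Finset.Icc 1 k) ∧
      (∀ v, #(f v) = 2) ∧ (∀ u ∈ A, ∀ w ∈ A, G.Adj u w → Disjoint (f u) (f w)) ∧
      ∀ u ∈ A, ∀ w ∈ A, ∀ z, u ≠ w → G.Adj u z → G.Adj z w → f u ≠ f w by
    obtain ⟨f, h₁, h₂, h₃, h₄⟩ := h Finset.univ
    exact ⟨f, isTToneColoring_two h₁ h₂ (fun u w => h₃ u (by simp) w (by simp))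
      fun u w z => h₄ u (by simp) w (by simp) z⟩
  intro A
  induction A using Finset.induction_on with
  | empty =>
    exact ⟨fun _ => {1, 2}, fun _ c hc => by simp at hc ⊢; omega, fun _ => rfl, by simp, by simp⟩
  | insert v A hv ih =>
    obtain ⟨f, h₁, h₂, h₃, h₄⟩ := ih
    obtain ⟨P, hP, hP2, hPN, hPM⟩ := exists_label (k := k) h₂ (G.neighborFinset v)
      (secondNeighbors G v) (by
        have hle : ∑ u ∈ G.neighborFinset v, (G.degree u - 1) ≤
            #(G.neighborFinset v) * (d - 1) := by
          refine Finset.sum_le_card_nsmul _ _ _ fun u _ => ?_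
          have := hd u
          omega
        rw [G.card_neighborFinset_eq_degree] at hle ⊢
        refine (card_secondNeighbors_le v).trans_lt (hle.trans_lt ?_)
        refine (Nat.mul_le_mul_right _ (hd v)).trans_lt (hk.trans_le ?_)
        have := hd v
        exact Nat.choose_le_choose 2 (by omega))
    have hNe : ∀ {u}, u ∈ A → u ≠ v := fun hu h => hv (h ▸ hu)
    refine ⟨Function.update f v P, fun u => ?_, fun u => ?_, fun u hu w hw huw => ?_,
      fun u hu w hw z huw huz hzw => ?_⟩
    · rcases eq_or_ne u v with rfl | h <;> simp [*]
    · rcases eq_or_ne u v with rfl | h <;> simp [*]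
    · rcases Finset.mem_insert.1 hu with rfl | hu' <;>
        rcases Finset.mem_insert.1 hw with rfl | hw'
      · exact absurd huw (G.irrefl)
      · simpa [hNe hw'] using hPN w (by simpa using huw)
      · simpa [hNe hu'] using (hPN u (by simpa using huw.symm)).symm
      · simpa [hNe hu', hNe hw'] using h₃ u hu' w hw' huw
    · rcases Finset.mem_insert.1 hu with rfl | hu' <;>
        rcases Finset.mem_insert.1 hw with rfl | hw'
      · exact absurd rfl huw
      · simpa [hNe hw'] using hPM w (mem_secondNeighbors huz hzw huw.symm)
      · simpa [hNe hu'] using (hPM u (mem_secondNeighbors hzw.symm huz.symm huw)).symm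
      · simpa [hNe hu', hNe hw'] using h₄ u hu' w hw' z huw huz hzw

theorem degree_contractInto_le {v x u : V} (hu : u ≠ x) :
    (contractInto G v x).degree u ≤ G.degree u := by
  rw [← SimpleGraph.card_neighborFinset_eq_degree, ← SimpleGraph.card_neighborFinset_eq_degree]
  by_cases huv : G.Adj u v
  · rw [← Finset.card_erase_add_one (show v ∈ G.neighborFinset u by simpa using huv)]
    refine (Finset.card_le_card fun w hw => ?_).trans
      (Finset.card_insert_le x ((G.neighborFinset u).erase v))
    simp only [SimpleGraph.mem_neighborFinset, Finset.mem_insert, Finset.mem_erase] at hw ⊢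
    obtain ⟨-, -, hwv, h | ⟨h, -⟩ | ⟨h, -⟩⟩ := hw
    · exact Or.inr ⟨hwv, h⟩
    · exact absurd h hu
    · exact Or.inl h
  · refine Finset.card_le_card fun w hw => ?_
    simp only [SimpleGraph.mem_neighborFinset] at hw ⊢
    obtain ⟨-, -, -, h | ⟨h, -⟩ | ⟨-, h⟩⟩ := hw
    · exact h
    · exact absurd h hu
    · exact absurd h.symm huv

theorem degree_contractInto_self_le {v x : V} (hvx : G.Adj v x) :
    (contractInto G v x).degree x + 2 ≤ G.degree x + G.degree v := by
  have hsub : (contractInto G v x).neighborFinset x ⊆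
      (G.neighborFinset x).erase v ∪ (G.neighborFinset v).erase x := by
    intro w hw
    simp only [SimpleGraph.mem_neighborFinset, Finset.mem_union, Finset.mem_erase] at hw ⊢
    obtain ⟨hxw, -, hwv, h | ⟨-, h⟩ | ⟨h, -⟩⟩ := hw
    · exact Or.inl ⟨hwv, h⟩
    · exact Or.inr ⟨hxw.symm, h⟩
    · exact absurd h.symm hxw
  have h₁ := (Finset.card_le_card hsub).trans (Finset.card_union_le _ _)
  have h₂ : #((G.neighborFinset x).erase v) + 1 = _ :=
    Finset.card_erase_add_one (by simpa using hvx.symm)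
  have h₃ : #((G.neighborFinset v).erase x) + 1 = _ :=
    Finset.card_erase_add_one (by simpa using hvx)
  simp only [SimpleGraph.card_neighborFinset_eq_degree] at h₁ h₂ h₃
  omega

/-- If all but two neighbors of `v` have degree less than `t`, the neighbors of `v` have few
further neighbors in total. -/
theorem sum_degree_sub_one_le {v : V} {t D : ℕ} (ht : 2 ≤ t) (htD : t ≤ D + 1)
    (hD : ∀ u, G.degree u ≤ D)
    (h : #{u ∈ G.neighborFinset v | t ≤ G.degree u} ≤ 2) (hv : 2 ≤ G.degree v) :
    ∑ u ∈ G.neighborFinset v, (G.degree u - 1) ≤ 2 * (D - 1) + (G.degree v - 2) * (t - 2) := by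
  have h₁ := Finset.sum_le_card_nsmul {u ∈ G.neighborFinset v | t ≤ G.degree u}
    (fun u => G.degree u - 1) (D - 1) fun u _ => by
      have := hD u
      omega
  have h₂ := Finset.sum_le_card_nsmul {u ∈ G.neighborFinset v | ¬ t ≤ G.degree u}
    (fun u => G.degree u - 1) (t - 2) fun u hu => by
      have := (Finset.mem_filter.1 hu).2
      omega
  have h₃ := Finset.card_filter_add_card_filter_not (s := G.neighborFinset v)
    fun u => t ≤ G.degree u
  rw [G.card_neighborFinset_eq_degree] at h₃
  rw [← Finset.sum_filter_add_sum_filter_not _ fun u => t ≤ G.degree u]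
  refine (add_le_add h₁ h₂).trans ?_
  obtain ⟨a, ha⟩ := Nat.exists_eq_add_of_le h
  obtain ⟨b, hb⟩ := Nat.exists_eq_add_of_le (show t - 2 ≤ D - 1 by omega)
  rw [show #{u ∈ G.neighborFinset v | ¬ t ≤ G.degree u} = G.degree v - 2 + a by omega,
    smul_eq_mul, smul_eq_mul, hb]
  nlinarith

theorem exists_neighbor_degree_lt {v : V} {t : ℕ}
    (h : #{u ∈ G.neighborFinset v | t ≤ G.degree u} < G.degree v) :
    ∃ x, G.Adj v x ∧ G.degree x < t := by
  by_contra! hcon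
  rw [Finset.filter_true_of_mem fun u hu => hcon u (by simpa using hu),
    G.card_neighborFinset_eq_degree] at h
  exact h.false

/-- A planar graph with an edge has an edge `vx` that can be contracted into `x` without
creating large degrees and such that `v` can be colored last. -/
theorem IsPlanar.exists_reducible (hG : IsPlanar G) {D k : ℕ} (hD : ∀ v, G.degree v ≤ D)
    (h204 : 204 ≤ D) (h41 : 41 ≤ k) (hk : 2 * (2 * D + 26) ≤ (k - 10) * (k - 11))
    {v₀ w₀ : V} (h₀ : G.Adj v₀ w₀) :
    ∃ v x, G.Adj v x ∧ G.degree x + G.degree v ≤ D + 2 ∧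
      ∑ u ∈ G.neighborFinset v, (G.degree u - 1) < (k - 2 * G.degree v).choose 2 := by
  obtain ⟨m, rfl⟩ := Nat.exists_eq_add_of_le h41
  have hch : ∀ n, (n + 2).choose 2 * 2 = (n + 2) * (n + 1) := fun n => by
    rw [Nat.choose_two_right, Nat.div_mul_cancel (Nat.even_mul_pred_self _).two_dvd]
    rfl
  rw [show 41 + m - 10 = m + 31 by omega, show 41 + m - 11 = m + 30 by omega] at hk
  obtain ⟨v, ⟨hpos, h2⟩ | ⟨h3, h⟩ | ⟨h4, h⟩ | ⟨h5, h⟩⟩ := hG.exists_light_vertex h₀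
  · obtain ⟨x, hx⟩ := (G.degree_pos_iff_exists_adj v).1 hpos
    refine ⟨v, x, hx, add_le_add (hD x) h2, ?_⟩
    have hle := Finset.sum_le_card_nsmul (G.neighborFinset v) (fun u => G.degree u - 1) (D - 1)
      fun u _ => by
        have := hD u
        omega
    rw [G.card_neighborFinset_eq_degree, smul_eq_mul] at hle
    have hle' := hle.trans (Nat.mul_le_mul_right _ h2)
    have hmono : (m + 37).choose 2 ≤ (41 + m - 2 * G.degree v).choose 2 :=
      Nat.choose_le_choose 2 (by omega)
    have := hch (m + 35)
    nlinarith [Nat.sub_le D 1]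
  · obtain ⟨x, hx, hlt⟩ := exists_neighbor_degree_lt (h.trans_lt (by omega))
    refine ⟨v, x, hx, by omega, ?_⟩
    have hle := sum_degree_sub_one_le (by omega) (by omega) hD h (by omega)
    have := hch (m + 33)
    rw [h3] at hle ⊢
    rw [show 41 + m - 2 * 3 = m + 33 + 2 by omega]
    have : D - 1 + 1 = D := by omega
    nlinarith
  · obtain ⟨x, hx, hlt⟩ := exists_neighbor_degree_lt (h.trans_lt (by omega))
    refine ⟨v, x, hx, by omega, ?_⟩
    have hle := sum_degree_sub_one_le (by omega) (by omega) hD h (by omega)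
    have := hch (m + 31)
    rw [h4] at hle ⊢
    rw [show 41 + m - 2 * 4 = m + 31 + 2 by omega]
    have : D - 1 + 1 = D := by omega
    nlinarith
  · obtain ⟨x, hx, hlt⟩ := exists_neighbor_degree_lt (h.trans_lt (by omega))
    refine ⟨v, x, hx, by omega, ?_⟩
    have hle := sum_degree_sub_one_le (by omega) (by omega) hD h (by omega)
    have := hch (m + 29)
    rw [h5] at hle ⊢
    rw [show 41 + m - 2 * 5 = m + 29 + 2 by omega]
    have : D - 1 + 1 = D := by omega
    nlinarith

theorem IsPlanar.exists_twoTone (hG : IsPlanar G) {D k : ℕ} (hD : ∀ v, G.degree v ≤ D)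
    (h204 : 204 ≤ D) (h41 : 41 ≤ k) (hk : 2 * (2 * D + 26) ≤ (k - 10) * (k - 11)) :
    ∃ f, IsTToneColoring G 2 k f := by
  suffices h : ∃ f : V → Finset ℕ, (∀ v, f v ⊆ Finset.Icc 1 k) ∧
      (∀ v, #(f v) = 2) ∧ (∀ u w, G.Adj u w → Disjoint (f u) (f w)) ∧
      ∀ u w z, u ≠ w → G.Adj u z → G.Adj z w → f u ≠ f w by
    obtain ⟨f, h₁, h₂, h₃, h₄⟩ := h
    exact ⟨f, isTToneColoring_two h₁ h₂ h₃ h₄⟩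
  obtain ⟨A, hA⟩ : ∃ A : Finset V, ∀ a b, G.Adj a b → a ∈ A := ⟨Finset.univ, by simp⟩
  induction hn : #A generalizing G A with
  | zero =>
    rw [Finset.card_eq_zero] at hn
    have hno : ∀ a b, ¬ G.Adj a b := fun a b h => by simpa [hn] using hA a b h
    exact ⟨fun _ => {1, 2}, fun _ c hc => by simp at hc ⊢; omega, fun _ => rfl,
      fun u w h => absurd h (hno u w), fun u w z _ h => absurd h (hno u z)⟩
  | succ n ih =>
    by_cases hE : ∃ a b, G.Adj a b
    · obtain ⟨v₀, w₀, h₀⟩ := hE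
      obtain ⟨v, x, hvx, hdeg, hsum⟩ := hG.exists_reducible hD h204 h41 hk h₀
      obtain ⟨f, h₁, h₂, h₃, h₄⟩ := ih (hG.contract hvx) (fun u => by
          rcases eq_or_ne u x with rfl | hu
          · have := degree_contractInto_self_le hvx
            omega
          · exact (degree_contractInto_le hu).trans (hD u)) (A.erase v)
        (contractInto_supported hA hvx) (by rw [Finset.card_erase_of_mem (hA _ _ hvx)]; omega)
      obtain ⟨P, hP, hP2, hPN, hPM⟩ := exists_label (k := k) h₂ (G.neighborFinset v)
        (secondNeighbors G v) (by
          rw [G.card_neighborFinset_eq_degree]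
          exact (card_secondNeighbors_le v).trans_lt hsum)
      have hkeep : ∀ {a b}, a ≠ v → b ≠ v → G.Adj a b → (contractInto G v x).Adj a b :=
        fun ha hb h => ⟨h.ne, ha, hb, Or.inl h⟩
      have hnew : ∀ {b}, b ≠ x → G.Adj v b → (contractInto G v x).Adj x b :=
        fun hb h => ⟨hb.symm, hvx.ne', h.ne', Or.inr (Or.inl ⟨rfl, h⟩)⟩
      have hdist : ∀ {a b}, (contractInto G v x).Adj a b → f a ≠ f b := fun {a _} h heq => by
        have h' := h₃ _ _ h
        rw [← heq, disjoint_self, Finset.bot_eq_empty] at h'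
        simpa [h'] using h₂ a
      refine ⟨Function.update f v P, fun u => ?_, fun u => ?_, fun u w huw => ?_,
        fun u w z huw huz hzw => ?_⟩
      · rcases eq_or_ne u v with rfl | h <;> simp [*]
      · rcases eq_or_ne u v with rfl | h <;> simp [*]
      · rcases eq_or_ne u v with rfl | hu
        · simpa [huw.ne'] using hPN w (by simpa using huw)
        rcases eq_or_ne w v with rfl | hw
        · simpa [hu] using (hPN u (by simpa using huw.symm)).symm
        simpa [hu, hw] using h₃ u w (hkeep hu hw huw)
      · rcases eq_or_ne u v with rfl | hu
        · simpa [huw.symm] using hPM w (mem_secondNeighbors huz hzw huw.symm)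
        rcases eq_or_ne w v with rfl | hw
        · simpa [hu] using (hPM u (mem_secondNeighbors hzw.symm huz.symm huw)).symm
        rw [Function.update_of_ne hu, Function.update_of_ne hw]
        rcases eq_or_ne z v with rfl | hz
        · rcases eq_or_ne u x with rfl | hux
          · exact hdist (hnew huw.symm hzw)
          rcases eq_or_ne w x with rfl | hwx
          · exact (hdist (hnew hux huz.symm)).symm
          exact h₄ u w x huw (hnew hux huz.symm).symm (hnew hwx hzw)
        · exact h₄ u w z huw (hkeep hu hz huz) (hkeep hz hw hzw)
    · have hno : ∀ a b, ¬ G.Adj a b := fun a b h => hE ⟨a, b, h⟩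
      exact ⟨fun _ => {1, 2}, fun _ c hc => by simp at hc ⊢; omega, fun _ => rfl,
        fun u w h => absurd h (hno u w), fun u w z _ h => absurd h (hno u z)⟩

theorem degree_le_maxDeg (v : V) : G.degree v ≤ maxDeg G := by
  have h : (G.neighborSet v).ncard = G.degree v := by
    rw [Set.ncard_eq_toFinset_card', ← G.card_neighborFinset_eq_degree]
    rfl
  rw [← h]
  exact Finset.le_sup (f := fun v => (G.neighborSet v).ncard) (Finset.mem_univ v)

theorem IsPlanar.toneChromaticNumber_two_le (hG : IsPlanar G) {k : ℕ} (h41 : 41 ≤ k)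
    (hk : ⌊Real.sqrt (4 * (maxDeg G : ℝ) + 50.25) + 11.5⌋₊ ≤ k) :
    toneChromaticNumber G 2 ≤ k := by
  refine Nat.sInf_le (hG.exists_twoTone (D := max (maxDeg G) 204)
    (fun v => (degree_le_maxDeg v).trans (le_max_left _ _)) (le_max_right _ _) h41 ?_)
  rcases le_total (maxDeg G) 204 with h | h
  · rw [max_eq_right h]
    exact (by norm_num : 2 * (2 * 204 + 26) ≤ 31 * 30).trans
      (Nat.mul_le_mul (by omega) (by omega))
  · rw [max_eq_left h]
    have hlt := (Nat.lt_floor_add_one (Real.sqrt (4 * (maxDeg G : ℝ) + 50.25) + 11.5)).trans_le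
      (add_le_add_left (Nat.cast_le.2 hk) 1)
    have hsq := Real.sq_sqrt (show (0 : ℝ) ≤ 4 * (maxDeg G : ℝ) + 50.25 by positivity)
    have hnn := Real.sqrt_nonneg (4 * (maxDeg G : ℝ) + 50.25)
    obtain ⟨m, rfl⟩ := Nat.exists_eq_add_of_le h41
    rw [show 41 + m - 10 = m + 31 by omega, show 41 + m - 11 = m + 30 by omega]
    push_cast at hlt
    have hreal : 2 * (2 * (maxDeg G : ℝ) + 25) < (m + 31) * (m + 30) := by nlinarith
    have hnat : 2 * (2 * maxDeg G + 25) < (m + 31) * (m + 30) := by exact_mod_cast hreal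
    have heven : Even ((m + 30) * (m + 30 + 1)) := Nat.even_mul_succ_self _
    obtain ⟨c, hc⟩ := heven
    have : (m + 31) * (m + 30) = c + c := by rw [← hc]; ring
    omega

end Coloring

/-- If `G` is a planar graph, then `τ₂(G) ≤ ⌊√(4Δ(G)+50.25) + 31.1⌋`; furthermore,
`τ₂(G) ≤ max {41, ⌊√(4Δ(G)+50.25) + 11.5⌋}`. -/
theorem two_tone_planar {V : Type*} [Fintype V] (G : SimpleGraph V) (hG : IsPlanar G) :
    toneChromaticNumber G 2 ≤ ⌊Real.sqrt (4 * (maxDeg G : ℝ) + 50.25) + 31.1⌋₊ ∧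
      toneChromaticNumber G 2 ≤
        max 41 ⌊Real.sqrt (4 * (maxDeg G : ℝ) + 50.25) + 11.5⌋₊ := by
  classical
  refine ⟨?_, hG.toneChromaticNumber_two_le (le_max_left _ _) (le_max_right _ _)⟩
  rcases le_or_gt (maxDeg G) 11 with h | h
  · have hfloor : 38 ≤ ⌊Real.sqrt (4 * (maxDeg G : ℝ) + 50.25) + 31.1⌋₊ := by
      refine Nat.le_floor ?_
      have : (6.9 : ℝ) ≤ Real.sqrt (4 * (maxDeg G : ℝ) + 50.25) := by
        refine Real.le_sqrt_of_sq_le ?_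
        have : (0 : ℝ) ≤ maxDeg G := Nat.cast_nonneg _
        norm_num
        linarith
      norm_num at this ⊢
      linarith
    refine Nat.sInf_le (exists_twoTone_of_degree_le (d := 11)
      (fun v => (degree_le_maxDeg v).trans h) ?_)
    exact (by decide : 11 * (11 - 1) < Nat.choose 16 2).trans_le
      (Nat.choose_le_choose 2 (by omega))
  · refine hG.toneChromaticNumber_two_le (Nat.le_floor ?_) (Nat.floor_le_floor (by norm_num))
    have : (9.9 : ℝ) ≤ Real.sqrt (4 * (maxDeg G : ℝ) + 50.25) := by
      refine Real.le_sqrt_of_sq_le ?_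
      have : (12 : ℝ) ≤ maxDeg G := by exact_mod_cast h
      norm_num
      linarith
    norm_num at this ⊢
    linarith
end

section
/- If G is a graph with mad(G) < 12/5, then τ₂(G) ≤ max{7, ⌈√(2Δ(G)+0.25) + 2.5⌉}. -/
open SimpleGraph

/-- `mad(G) < q`: every nonempty set `S` of vertices induces a subgraph whose
average degree `2|E(G[S])|/|S|` is less than `q`. -/
def MadLT {V : Type*} (G : SimpleGraph V) (q : ℚ) : Prop :=
  ∀ S : Finset V, S.Nonempty →
    (2 * ({e ∈ G.edgeSet | ∀ v ∈ e, v ∈ S}.ncard : ℚ)) / S.card < q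

/-- `f` labels the vertices of `C` by 2-subsets of `P` in such a way that adjacent vertices of `C`
get disjoint labels, and vertices of `C` with a common neighbor in `G` get distinct labels. -/
structure IsPartialTwoTone {V : Type*} (G : SimpleGraph V) (P : Finset ℕ) (C : Set V)
    (f : V → Finset ℕ) : Prop where
  mem : ∀ v ∈ C, f v ∈ P.powersetCard 2
  disjoint : ∀ v ∈ C, ∀ w ∈ C, G.Adj v w → Disjoint (f v) (f w)
  ne : ∀ v ∈ C, ∀ w ∈ C, v ≠ w → ∀ u, G.Adj u v → G.Adj u w → f v ≠ f w

namespace IsPartialTwoTone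

variable {V : Type*} {G : SimpleGraph V} {P : Finset ℕ} {C : Set V}
  {f : V → Finset ℕ}

theorem mono {D : Set V} (h : IsPartialTwoTone G P C f) (hD : D ⊆ C) :
    IsPartialTwoTone G P D f :=
  ⟨fun v hv => h.mem v (hD hv), fun v hv w hw => h.disjoint v (hD hv) w (hD hw),
    fun v hv w hw => h.ne v (hD hv) w (hD hw)⟩

theorem subset (h : IsPartialTwoTone G P C f) {v : V} (hv : v ∈ C) : f v ⊆ P :=
  (Finset.mem_powersetCard.1 (h.mem v hv)).1

theorem card (h : IsPartialTwoTone G P C f) {v : V} (hv : v ∈ C) : (f v).card = 2 :=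
  (Finset.mem_powersetCard.1 (h.mem v hv)).2

variable [DecidableEq V]

theorem insert_update (h : IsPartialTwoTone G P C f) {u : V} (hu : u ∉ C) {L : Finset ℕ}
    (hL : L ∈ P.powersetCard 2) (hdisj : ∀ n ∈ C, G.Adj u n → Disjoint L (f n))
    (hne : ∀ m ∈ C, ∀ n, G.Adj u n → G.Adj n m → L ≠ f m) :
    IsPartialTwoTone G P (insert u C) (Function.update f u L) := by
  have hf : ∀ v ∈ C, Function.update f u L v = f v := fun v hv =>
    Function.update_of_ne (fun e : v = u => hu (e ▸ hv)) _ _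
  have hfu : Function.update f u L u = L := Function.update_self _ _ _
  refine ⟨?_, ?_, ?_⟩
  · rintro v (rfl | hv)
    · rwa [hfu]
    · rw [hf v hv]; exact h.mem v hv
  · rintro v (rfl | hv) w (rfl | hw) hvw
    · exact (G.loopless.irrefl _ hvw).elim
    · rw [hfu, hf w hw]; exact hdisj w hw hvw
    · rw [hfu, hf v hv]; exact (hdisj v hv hvw.symm).symm
    · rw [hf v hv, hf w hw]; exact h.disjoint v hv w hw hvw
  · rintro v (rfl | hv) w (rfl | hw) hvw x hxv hxw
    · exact (hvw rfl).elim
    · rw [hfu, hf w hw]; exact hne w hw x hxv.symm hxw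
    · rw [hfu, hf v hv]; exact (hne v hv x hxw.symm hxv).symm
    · rw [hf v hv, hf w hw]; exact h.ne v hv w hw hvw x hxv hxw

/-- A vertex far from all colored vertices can be colored. -/
theorem insert_far (h : IsPartialTwoTone G P C f) {u : V} (hu : u ∉ C) (hP : 2 ≤ P.card)
    (hadj : ∀ n ∈ C, ¬ G.Adj u n) (hadj2 : ∀ m ∈ C, ∀ n, G.Adj u n → ¬ G.Adj n m) :
    ∃ g, IsPartialTwoTone G P (insert u C) g := by
  obtain ⟨L, hL⟩ := Finset.powersetCard_nonempty.2 hP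
  exact ⟨_, h.insert_update hu hL (fun n hn hun => (hadj n hn hun).elim)
    (fun m hm n hun hnm => (hadj2 m hm n hun hnm).elim)⟩

theorem card_powersetCard_sdiff (A : Finset ℕ) (hA : A ⊆ P) :
    ((P \ A).powersetCard 2).card = (P.card - A.card).choose 2 := by
  rw [Finset.card_powersetCard, Finset.card_sdiff_of_subset hA]

theorem mem_powersetCard_sdiff {A L : Finset ℕ} :
    L ∈ (P \ A).powersetCard 2 ↔ L ∈ P.powersetCard 2 ∧ Disjoint L A := by
  simp only [Finset.mem_powersetCard, Finset.subset_sdiff]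
  tauto

/-- A vertex with a unique colored neighbor `a` can be colored if `a` has small degree. -/
theorem insert_pendant [Fintype V] [DecidableRel G.Adj] (h : IsPartialTwoTone G P C f) {u a : V}
    (hu : u ∉ C) (ha : a ∈ C) (hua : G.Adj u a) (hadj : ∀ n ∈ C, G.Adj u n → n = a) (M : Finset V)
    (hadj2 : ∀ m ∈ C, ∀ n, G.Adj u n → G.Adj n m → n = a ∨ m ∈ M)
    (hcard : M.card + G.degree a ≤ (P.card - 2).choose 2) :
    ∃ g, IsPartialTwoTone G P (insert u C) g := by
  have hlt : ((((G.neighborFinset a).erase u) ∪ M).image f).card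
      < ((P \ f a).powersetCard 2).card := by
    rw [card_powersetCard_sdiff _ (h.subset ha), h.card ha]
    have hmem : u ∈ G.neighborFinset a := by simpa using hua.symm
    have h1 := Finset.card_erase_add_one hmem
    rw [G.card_neighborFinset_eq_degree] at h1
    have h2 := Finset.card_union_le ((G.neighborFinset a).erase u) M
    have h3 := Finset.card_image_le (s := ((G.neighborFinset a).erase u) ∪ M) (f := f)
    omega
  obtain ⟨L, hL, hLn⟩ := Finset.exists_mem_notMem_of_card_lt_card hlt
  rw [mem_powersetCard_sdiff] at hL
  refine ⟨_, h.insert_update hu hL.1 (fun n hn hun => hadj n hn hun ▸ hL.2) ?_⟩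
  rintro m hm n hun hnm rfl
  refine hLn (Finset.mem_image_of_mem f ?_)
  rcases hadj2 m hm n hun hnm with rfl | hM
  · have : m ≠ u := fun e => hu (e ▸ hm)
    simp [this, hnm]
  · exact Finset.mem_union_right _ hM

theorem three_le_choose_two {n : ℕ} (hn : 3 ≤ n) : 3 ≤ n.choose 2 :=
  (by decide : 3 ≤ Nat.choose 3 2).trans (Nat.choose_le_choose 2 hn)

/-- A vertex with two colored neighbors can be colored if at most two colored vertices are at
distance two from it. -/
theorem insert_between (h : IsPartialTwoTone G P C f) {u p q : V} (hP : 7 ≤ P.card)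
    (hu : u ∉ C) (hp : p ∈ C) (hq : q ∈ C) (hadj : ∀ n ∈ C, G.Adj u n → n = p ∨ n = q)
    (M : Finset V) (hadj2 : ∀ m ∈ C, ∀ n, G.Adj u n → G.Adj n m → m ∈ M) (hM : M.card ≤ 2) :
    ∃ g, IsPartialTwoTone G P (insert u C) g := by
  have hlt : (M.image f).card < ((P \ (f p ∪ f q)).powersetCard 2).card := by
    rw [card_powersetCard_sdiff _ (Finset.union_subset (h.subset hp) (h.subset hq))]
    have h1 := Finset.card_union_le (f p) (f q)
    rw [h.card hp, h.card hq] at h1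
    have h2 := three_le_choose_two (n := P.card - (f p ∪ f q).card) (by omega)
    have h3 := Finset.card_image_le (s := M) (f := f)
    omega
  obtain ⟨L, hL, hLn⟩ := Finset.exists_mem_notMem_of_card_lt_card hlt
  rw [mem_powersetCard_sdiff, Finset.disjoint_union_right] at hL
  refine ⟨_, h.insert_update hu hL.1 ?_ ?_⟩
  · intro n hn hun
    rcases hadj n hn hun with rfl | rfl
    exacts [hL.2.1, hL.2.2]
  · rintro m hm n hun hnm rfl
    exact hLn (Finset.mem_image_of_mem f (hadj2 m hm n hun hnm))

theorem choose_two_sub (k : ℕ) (hk : 7 ≤ k) :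
    (k - 2).choose 2 = (k - 4).choose 2 + (2 * k - 7) ∧ 3 ≤ (k - 4).choose 2 ∧
      6 ≤ (k - 3).choose 2 := by
  obtain ⟨m, rfl⟩ := Nat.exists_eq_add_of_le hk
  have e1 : 7 + m - 2 = (m + 3) + 1 + 1 := by omega
  have e2 : 7 + m - 4 = m + 3 := by omega
  have e3 : 7 + m - 3 = (m + 3) + 1 := by omega
  have h3 := three_le_choose_two (n := m + 3) (by omega)
  rw [e1, e2, e3]
  simp only [Nat.choose_succ_succ' _ 1, Nat.choose_one_right] at *
  omega

/-- The pure label choice behind `insert_path`: a path `v - x - y - a` with `v` and `a` labelled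
`A` and `B` can be labelled. -/
theorem exists_path_labels {A B : Finset ℕ} (hP : 7 ≤ P.card) (hA : A ∈ P.powersetCard 2)
    (hB : B ∈ P.powersetCard 2) (F E : Finset (Finset ℕ)) (hF : F.card ≤ 4) (hE : E.card ≤ 2) :
    ∃ Y ∈ P.powersetCard 2, Disjoint Y B ∧ Y ∉ F ∧ Y ≠ A ∧
      ∃ X ∈ P.powersetCard 2, Disjoint X A ∧ Disjoint X Y ∧ X ≠ B ∧ X ∉ E := by
  obtain ⟨hk, hk4, hk3⟩ := choose_two_sub P.card hP
  obtain ⟨hAP, hAc⟩ := Finset.mem_powersetCard.1 hA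
  obtain ⟨hBP, hBc⟩ := Finset.mem_powersetCard.1 hB
  have hcB : ((P \ B).powersetCard 2).card = (P.card - 2).choose 2 := by
    rw [card_powersetCard_sdiff _ hBP, hBc]
  by_cases hAB : Disjoint A B
  · have hlt : (insert A F ∪ (P \ (A ∪ B)).powersetCard 2).card
        < ((P \ B).powersetCard 2).card := by
      have h1 := Finset.card_union_le (insert A F) ((P \ (A ∪ B)).powersetCard 2)
      have h2 := Finset.card_insert_le A F
      rw [card_powersetCard_sdiff _ (Finset.union_subset hAP hBP),
        Finset.card_union_of_disjoint hAB, hAc, hBc,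
        show P.card - (2 + 2) = P.card - 4 from rfl] at h1
      omega
    obtain ⟨Y, hY, hYn⟩ := Finset.exists_mem_notMem_of_card_lt_card hlt
    rw [mem_powersetCard_sdiff] at hY
    simp only [Finset.mem_union, Finset.mem_insert, mem_powersetCard_sdiff, not_or] at hYn
    obtain ⟨⟨hYA, hYF⟩, hYAB⟩ := hYn
    obtain ⟨hYP, hYc⟩ := Finset.mem_powersetCard.1 hY.1
    have hYA' : ¬ Disjoint A Y := fun hd => hYAB
      ⟨hY.1, Finset.disjoint_union_right.2 ⟨hd.symm, hY.2⟩⟩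
    have hcAY : (A ∪ Y).card ≤ 3 := by
      have h1 := Finset.card_union_add_card_inter A Y
      have h2 : 0 < (A ∩ Y).card := by
        rw [Finset.card_pos, Finset.nonempty_iff_ne_empty]
        exact fun e => hYA' (Finset.disjoint_iff_inter_eq_empty.2 e)
      omega
    have hlt2 : (insert B E).card < ((P \ (A ∪ Y)).powersetCard 2).card := by
      rw [card_powersetCard_sdiff _ (Finset.union_subset hAP hYP)]
      have h1 := Nat.choose_le_choose 2 (show P.card - 3 ≤ P.card - (A ∪ Y).card by omega)
      have h2 := Finset.card_insert_le B E
      omega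
    obtain ⟨X, hX, hXn⟩ := Finset.exists_mem_notMem_of_card_lt_card hlt2
    rw [mem_powersetCard_sdiff, Finset.disjoint_union_right] at hX
    simp only [Finset.mem_insert, not_or] at hXn
    exact ⟨Y, hY.1, hY.2, hYF, hYA, X, hX.1, hX.2.1, hX.2.2, hXn.1, hXn.2⟩
  · have hlt : (insert A F).card < ((P \ B).powersetCard 2).card := by
      have h2 := Finset.card_insert_le A F
      omega
    obtain ⟨Y, hY, hYn⟩ := Finset.exists_mem_notMem_of_card_lt_card hlt
    rw [mem_powersetCard_sdiff] at hY
    simp only [Finset.mem_insert, not_or] at hYn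
    obtain ⟨hYP, hYc⟩ := Finset.mem_powersetCard.1 hY.1
    have hlt2 : E.card < ((P \ (A ∪ Y)).powersetCard 2).card := by
      rw [card_powersetCard_sdiff _ (Finset.union_subset hAP hYP)]
      have h1 := Finset.card_union_le A Y
      have h2 := Nat.choose_le_choose 2 (show P.card - 4 ≤ P.card - (A ∪ Y).card by omega)
      omega
    obtain ⟨X, hX, hXn⟩ := Finset.exists_mem_notMem_of_card_lt_card hlt2
    rw [mem_powersetCard_sdiff, Finset.disjoint_union_right] at hX
    refine ⟨Y, hY.1, hY.2, hYn.2, hYn.1, X, hX.1, hX.2.1, hX.2.2, ?_, hXn⟩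
    rintro rfl
    exact hAB hX.2.1.symm

/-- The two inner vertices of a path `v - x - y - a` (possibly `v = a`) can be colored when they
have degree two and `v`, `a` have small degree. -/
theorem insert_path [Fintype V] [DecidableRel G.Adj] (h : IsPartialTwoTone G P C f)
    {v x y a : V} (hP : 7 ≤ P.card) (hv : v ∈ C) (ha : a ∈ C) (hx : x ∉ C) (hy : y ∉ C)
    (hxy : x ≠ y) (hNx : ∀ n, G.Adj x n ↔ n = v ∨ n = y) (hNy : ∀ n, G.Adj y n ↔ n = x ∨ n = a)
    (hdv : G.degree v ≤ 3) (hda : G.degree a ≤ 5) :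
    ∃ g, IsPartialTwoTone G P (insert x (insert y C)) g := by
  have hc : ∀ {u b : V}, G.Adj b u →
      (((G.neighborFinset b).erase u).image f).card + 1 ≤ G.degree b := by
    intro u b hbu
    have h1 := Finset.card_erase_add_one (show u ∈ G.neighborFinset b by simpa using hbu)
    rw [G.card_neighborFinset_eq_degree] at h1
    have h2 := Finset.card_image_le (s := (G.neighborFinset b).erase u) (f := f)
    omega
  have hva : G.Adj v x := ((hNx v).2 (Or.inl rfl)).symm
  have hay : G.Adj a y := ((hNy a).2 (Or.inr rfl)).symm
  obtain ⟨Y, hY, hYB, hYF, hYA, X, hX, hXA, hXY, hXB, hXE⟩ :=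
    exists_path_labels hP (h.mem v hv) (h.mem a ha)
      (((G.neighborFinset a).erase y).image f) (((G.neighborFinset v).erase x).image f)
      (by have := hc hay; omega) (by have := hc hva; omega)
  have h1 : IsPartialTwoTone G P (insert y C) (Function.update f y Y) := by
    refine h.insert_update hy hY ?_ ?_
    · intro n hn hyn
      rcases (hNy n).1 hyn with rfl | rfl
      · exact (hx hn).elim
      · exact hYB
    · rintro m hm n hyn hnm rfl
      have hmy : m ≠ y := fun e => hy (e ▸ hm)
      rcases (hNy n).1 hyn with rfl | rfl
      · rcases (hNx m).1 hnm with rfl | rfl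
        · exact hYA rfl
        · exact hmy rfl
      · exact hYF (Finset.mem_image_of_mem f (by simp [hmy, hnm]))
  have hf : ∀ w ∈ C, Function.update f y Y w = f w := fun w hw =>
    Function.update_of_ne (fun e : w = y => hy (e ▸ hw)) _ _
  refine ⟨_, h1.insert_update (u := x) (L := X) (by simp [hxy, hx]) hX ?_ ?_⟩
  · intro n _ hxn
    rcases (hNx n).1 hxn with rfl | rfl
    · rw [hf _ hv]; exact hXA
    · rw [Function.update_self]; exact hXY
  · intro m hm n hxn hnm
    rcases (hNx n).1 hxn with rfl | rfl
    · rcases hm with rfl | hm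
      · rw [Function.update_self]
        rintro rfl
        have := Finset.disjoint_self_iff_empty _ |>.1 hXY
        simp [this] at hX
      · rw [hf m hm]
        rintro rfl
        have hmx : m ≠ x := fun e => hx (e ▸ hm)
        exact hXE (Finset.mem_image_of_mem f (by simp [hmx, hnm]))
    · rcases (hNy m).1 hnm with rfl | rfl
      · rcases hm with e | hm
        · exact (hxy e).elim
        · exact (hx hm).elim
      · rw [hf m ha]; exact hXB

end IsPartialTwoTone

section Neighbors

variable {V : Type*} [Fintype V] [DecidableEq V] {G : SimpleGraph V} [DecidableRel G.Adj]

theorem exists_adj_iff_of_degree_eq_two {x v : V} (hx : G.degree x = 2) (hv : G.Adj x v) :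
    ∃ x', x' ≠ v ∧ ∀ n, G.Adj x n ↔ n = v ∨ n = x' := by
  have hmem : v ∈ G.neighborFinset x := by simpa using hv
  obtain ⟨x', hx'⟩ := Finset.card_eq_one.1 (show ((G.neighborFinset x).erase v).card = 1 by
    rw [Finset.card_erase_of_mem hmem, G.card_neighborFinset_eq_degree, hx])
  have h : ∀ n, (n ≠ v ∧ G.Adj x n) ↔ n = x' := by
    intro n
    rw [← Finset.mem_singleton, ← hx']; simp
  refine ⟨x', ((h x').2 rfl).1, fun n => ?_⟩
  have := h n
  by_cases hn : n = v
  · simp [hn, hv]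
  · simpa [hn] using this

theorem exists_adj_iff_of_degree_eq_three {v x y : V} (hv : G.degree v = 3) (hx : G.Adj v x)
    (hy : G.Adj v y) (hxy : x ≠ y) :
    ∃ w, w ≠ x ∧ w ≠ y ∧ ∀ n, G.Adj v n ↔ n = x ∨ n = y ∨ n = w := by
  have hmx : x ∈ G.neighborFinset v := by simpa using hx
  have hmy : y ∈ (G.neighborFinset v).erase x := by simpa using ⟨hxy.symm, hy⟩
  obtain ⟨w, hw⟩ := Finset.card_eq_one.1
    (show (((G.neighborFinset v).erase x).erase y).card = 1 by
      rw [Finset.card_erase_of_mem hmy, Finset.card_erase_of_mem hmx,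
        G.card_neighborFinset_eq_degree, hv])
  have h : ∀ n, (n ≠ y ∧ n ≠ x ∧ G.Adj v n) ↔ n = w := by
    intro n
    rw [← Finset.mem_singleton, ← hw]; simp
  refine ⟨w, ((h w).2 rfl).2.1, ((h w).2 rfl).1, fun n => ?_⟩
  have := h n
  by_cases hn : n = x
  · simp [hn, hx]
  · by_cases hn' : n = y
    · simp [hn', hy]
    · simpa [hn, hn'] using this

end Neighbors

/-- A graph without 2-tone coloring from `P` in which every nonempty `S` all of whose vertices have
at most one neighbor outside `S` can be deleted to leave a colorable graph. -/
structure IsCriticalTwoTone {V : Type*} [Fintype V] (G : SimpleGraph V) [DecidableRel G.Adj]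
    (P : Finset ℕ) : Prop where
  card : 7 ≤ P.card
  degree_le : ∀ v, G.degree v ≤ (P.card - 2).choose 2
  not_univ : ∀ f, ¬ IsPartialTwoTone G P Set.univ f
  exists_compl : ∀ S : Set V, S.Nonempty →
    (∀ s ∈ S, ∀ n ∉ S, ∀ m ∉ S, G.Adj s n → G.Adj s m → n = m) →
    ∃ f, IsPartialTwoTone G P Sᶜ f

namespace IsCriticalTwoTone

variable {V : Type*} [Fintype V] {G : SimpleGraph V} [DecidableRel G.Adj] {P : Finset ℕ}

theorem not_of_forall_mem (h : IsCriticalTwoTone G P) {C : Set V} (hC : ∀ v, v ∈ C)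
    (f : V → Finset ℕ) : ¬ IsPartialTwoTone G P C f :=
  fun hf => h.not_univ f (hf.mono fun v _ => hC v)

theorem ten_le (h : IsCriticalTwoTone G P) : 10 ≤ (P.card - 2).choose 2 :=
  (by decide : 10 ≤ Nat.choose 5 2).trans
    (Nat.choose_le_choose 2 (by have := h.card; omega))

variable [DecidableEq V]

theorem two_le_degree (h : IsCriticalTwoTone G P) (v : V) : 2 ≤ G.degree v := by
  by_contra! hv
  have huniq : ∀ n m, G.Adj v n → G.Adj v m → n = m := by
    have : (G.neighborFinset v).card ≤ 1 := by rw [G.card_neighborFinset_eq_degree]; omega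
    intro n m hn hm
    exact Finset.card_le_one.1 this n (by simpa using hn) m (by simpa using hm)
  obtain ⟨f, hf⟩ := h.exists_compl {v} ⟨v, rfl⟩ (by
    rintro s rfl n _ m _
    exact huniq n m)
  have hcov : ∀ w, w ∈ insert v ({v}ᶜ : Set V) := fun w => by simp [em]
  have hP := h.card
  by_cases hn : ∃ a, G.Adj v a
  · obtain ⟨a, ha⟩ := hn
    obtain ⟨g, hg⟩ := hf.insert_pendant (u := v) (a := a) (by simp) (by simpa using ha.ne') ha
      (fun n _ hn => huniq n a hn ha) ∅ (fun m _ n hn _ => Or.inl (huniq n a hn ha))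
      (by simpa using h.degree_le a)
    exact h.not_of_forall_mem hcov g hg
  · push Not at hn
    obtain ⟨g, hg⟩ := hf.insert_far (u := v) (by simp) (by omega) (fun n _ => hn n)
      (fun m _ n hvn => (hn n hvn).elim)
    exact h.not_of_forall_mem hcov g hg

/-- Three consecutive vertices of degree two are followed by a vertex of degree at least six. -/
theorem six_le_degree_of_thread (h : IsCriticalTwoTone G P) {x y z b : V} (hx : G.degree x = 2)
    (hy : G.degree y = 2) (hz : G.degree z = 2) (hyx : G.Adj y x) (hyz : G.Adj y z) (hxz : x ≠ z)
    (hzb : G.Adj z b) (hby : b ≠ y) : 6 ≤ G.degree b := by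
  by_contra! hb
  have hP := h.card
  have h10 := h.ten_le
  obtain ⟨z', hz', hNy⟩ := exists_adj_iff_of_degree_eq_two hy hyx
  obtain rfl : z = z' := by have := (hNy z).1 hyz; grind
  obtain ⟨b', hb', hNz⟩ := exists_adj_iff_of_degree_eq_two hz hyz.symm
  obtain rfl : b = b' := by have := (hNz b).1 hzb; grind
  obtain ⟨a, ha, hNx⟩ := exists_adj_iff_of_degree_eq_two hx hyx.symm
  have hyx' := hyx.ne
  have hyz' := hyz.ne
  have hzb' := hzb.ne
  have hxa' := ((hNx a).2 (Or.inr rfl)).ne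
  obtain ⟨f, hf⟩ := h.exists_compl {x, y, z} ⟨x, by simp⟩ (by
    intro s hs n hn m hm hsn hsm
    simp only [Set.mem_insert_iff, Set.mem_singleton_iff] at hs hn hm
    grind)
  by_cases haz : a = z
  · subst haz
    obtain rfl : x = b := by have := (hNz x).1 ((hNx a).2 (Or.inr rfl)).symm; grind
    obtain ⟨g, hg⟩ := hf.insert_far (u := x) (by simp) (by omega)
      (by simp only [Set.mem_compl_iff, Set.mem_insert_iff, Set.mem_singleton_iff]; grind)
      (by simp only [Set.mem_compl_iff, Set.mem_insert_iff, Set.mem_singleton_iff]; grind)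
    obtain ⟨g', hg'⟩ := hg.insert_path (v := x) (x := y) (y := a) (a := x) hP (by simp) (by simp)
      (by simp; grind) (by simp; grind) hyz' hNy hNz (by omega) (by omega)
    refine h.not_of_forall_mem ?_ g' hg'
    intro v
    simp only [Set.mem_compl_iff, Set.mem_insert_iff, Set.mem_singleton_iff]
    tauto
  · have hbx : b ≠ x := by
      rintro rfl
      have := (hNx z).1 hzb.symm
      grind
    obtain ⟨g, hg⟩ := hf.insert_pendant (u := x) (a := a) (by simp) (by simp; grind)
      ((hNx a).2 (Or.inr rfl))
      (by simp only [Set.mem_compl_iff, Set.mem_insert_iff, Set.mem_singleton_iff]; grind) ∅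
      (by simp only [Set.mem_compl_iff, Set.mem_insert_iff, Set.mem_singleton_iff]; grind)
      (by simpa using h.degree_le a)
    obtain ⟨g, hg⟩ := hg.insert_pendant (u := z) (a := b) (by simp; grind) (by simp; grind) hzb
      (by simp only [Set.mem_compl_iff, Set.mem_insert_iff, Set.mem_singleton_iff]; grind) {x}
      (by
        simp only [Set.mem_compl_iff, Set.mem_insert_iff, Set.mem_singleton_iff,
          Finset.mem_singleton]
        grind)
      (by rw [Finset.card_singleton]; omega)
    obtain ⟨g, hg⟩ := hg.insert_between (u := y) (p := x) (q := z) hP (by simp; grind) (by simp)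
      (by simp) (fun n _ => (hNy n).1) {a, b}
      (by
        simp only [Set.mem_compl_iff, Set.mem_insert_iff, Set.mem_singleton_iff,
          Finset.mem_singleton, Finset.mem_insert]
        grind)
      Finset.card_le_two
    refine h.not_of_forall_mem ?_ g hg
    intro v
    simp only [Set.mem_compl_iff, Set.mem_insert_iff, Set.mem_singleton_iff]
    tauto

/-- No triangle has degrees `3, 2, 2`. -/
theorem not_triangle (h : IsCriticalTwoTone G P) {v x y : V} (hv : G.degree v = 3)
    (hx : G.degree x = 2) (hy : G.degree y = 2) (hvx : G.Adj v x) (hvy : G.Adj v y) :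
    ¬ G.Adj x y := by
  intro hxy
  have hP := h.card
  obtain ⟨y', hy', hNx⟩ := exists_adj_iff_of_degree_eq_two hx hvx.symm
  obtain rfl : y = y' := by have := (hNx y).1 hxy; have := hvy.ne; grind
  obtain ⟨v', hv', hNy⟩ := exists_adj_iff_of_degree_eq_two hy hxy.symm
  obtain rfl : v = v' := by have := (hNy v).1 hvy.symm; have := hvx.ne; grind
  obtain ⟨w, hwx, hwy, hNv⟩ := exists_adj_iff_of_degree_eq_three hv hvx hvy hxy.ne
  have hvw := (hNv w).2 (by simp)
  have hvw' := hvw.ne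
  have hvx' := hvx.ne
  have hvy' := hvy.ne
  have hxy' := hxy.ne
  obtain ⟨f, hf⟩ := h.exists_compl {v, x, y} ⟨x, by simp⟩ (by
    intro s hs n hn m hm hsn hsm
    simp only [Set.mem_insert_iff, Set.mem_singleton_iff] at hs hn hm
    grind)
  obtain ⟨g, hg⟩ := hf.insert_pendant (u := v) (a := w) (by simp) (by simp; grind) hvw
    (by simp only [Set.mem_compl_iff, Set.mem_insert_iff, Set.mem_singleton_iff]; grind) ∅
    (by simp only [Set.mem_compl_iff, Set.mem_insert_iff, Set.mem_singleton_iff]; grind)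
    (by simpa using h.degree_le w)
  obtain ⟨g, hg⟩ := hg.insert_path (v := v) (x := x) (y := y) (a := v) hP (by simp) (by simp)
    (by simp; grind) (by simp; grind) hxy' hNx hNy (by omega) (by omega)
  refine h.not_of_forall_mem ?_ g hg
  intro v
  simp only [Set.mem_compl_iff, Set.mem_insert_iff, Set.mem_singleton_iff]
  tauto

/-- A vertex of degree three is not the end of two threads with two inner vertices whose other ends
have degree at most five. -/
theorem not_two_threads (h : IsCriticalTwoTone G P) {v x x' a y y' b : V} (hv : G.degree v = 3)
    (hx : G.degree x = 2) (hx' : G.degree x' = 2) (hy : G.degree y = 2) (hy' : G.degree y' = 2)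
    (hvx : G.Adj v x) (hxx' : G.Adj x x') (hx'a : G.Adj x' a) (hvx' : x' ≠ v) (hxa : a ≠ x)
    (hvy : G.Adj v y) (hyy' : G.Adj y y') (hy'b : G.Adj y' b) (hvy' : y' ≠ v) (hyb : b ≠ y)
    (hxy : x ≠ y) (ha : G.degree a ≤ 5) (hb : G.degree b ≤ 5) : False := by
  have hP := h.card
  obtain ⟨x₀, hx₀, hNx⟩ := exists_adj_iff_of_degree_eq_two hx hvx.symm
  obtain rfl : x' = x₀ := by have := (hNx x').1 hxx'; grind
  obtain ⟨y₀, hy₀, hNy⟩ := exists_adj_iff_of_degree_eq_two hy hvy.symm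
  obtain rfl : y' = y₀ := by have := (hNy y').1 hyy'; grind
  obtain ⟨a₀, ha₀, hNx'⟩ := exists_adj_iff_of_degree_eq_two hx' hxx'.symm
  obtain rfl : a = a₀ := by have := (hNx' a).1 hx'a; grind
  obtain ⟨b₀, hb₀, hNy'⟩ := exists_adj_iff_of_degree_eq_two hy' hyy'.symm
  obtain rfl : b = b₀ := by have := (hNy' b).1 hy'b; grind
  obtain ⟨w, hwx, hwy, hNv⟩ := exists_adj_iff_of_degree_eq_three hv hvx hvy hxy
  have hvw := (hNv w).2 (by simp)
  have hvw' := hvw.ne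
  have hvx₁ := hvx.ne
  have hvy₁ := hvy.ne
  have hxx₁ := hxx'.ne
  have hyy₁ := hyy'.ne
  have hx'v : ¬ G.Adj v x' := fun e => h.not_triangle hv hx hx' hvx e hxx'
  have hy'v : ¬ G.Adj v y' := fun e => h.not_triangle hv hy hy' hvy e hyy'
  have hx'y' : x' ≠ y' := by
    rintro rfl
    have := h.six_le_degree_of_thread hx hx' hy hxx'.symm hyy'.symm hxy hvy.symm hvx'.symm
    omega
  have hay' : a ≠ y' := by
    rintro rfl
    have := h.six_le_degree_of_thread hy' hx' hx hx'a hxx'.symm (by grind) hvx.symm hvx'.symm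
    omega
  obtain ⟨f, hf⟩ := h.exists_compl {v, x, x', y, y'} ⟨x, by simp⟩ (by
    intro s hs n hn m hm hsn hsm
    simp only [Set.mem_insert_iff, Set.mem_singleton_iff] at hs hn hm
    grind)
  have hax := hx'a.ne
  have hby := hy'b.ne
  have hav : a ≠ v := by rintro rfl; exact hx'v hx'a.symm
  have hbv : b ≠ v := by rintro rfl; exact hy'v hy'b.symm
  have hay : a ≠ y := by
    rintro rfl
    have := (hNy x').1 hx'a.symm
    grind
  have hbx : b ≠ x := by
    rintro rfl
    have := (hNx y').1 hy'b.symm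
    grind
  have hbx' : b ≠ x' := by
    rintro rfl
    have := (hNx' y').1 hy'b.symm
    grind
  have hwx' : w ≠ x' := by rintro rfl; exact hx'v hvw
  have hwy' : w ≠ y' := by rintro rfl; exact hy'v hvw
  have hx'y : x' ≠ y := by rintro rfl; exact hx'v hvy
  have hy'x : y' ≠ x := by rintro rfl; exact hy'v hvx
  obtain ⟨g, hg⟩ := hf.insert_pendant (u := v) (a := w) (by simp) (by simp; grind) hvw
    (by simp only [Set.mem_compl_iff, Set.mem_insert_iff, Set.mem_singleton_iff]; grind) ∅
    (by simp only [Set.mem_compl_iff, Set.mem_insert_iff, Set.mem_singleton_iff]; grind)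
    (by simpa using h.degree_le w)
  obtain ⟨g, hg⟩ := hg.insert_path (v := v) (x := x) (y := x') (a := a) hP (by simp)
    (by simp; grind) (by simp; grind) (by simp; grind) hxx₁ hNx hNx' (by omega) ha
  obtain ⟨g, hg⟩ := hg.insert_path (v := v) (x := y) (y := y') (a := b) hP (by simp)
    (by simp; grind) (by simp; grind) (by simp; grind) hyy₁ hNy hNy' (by omega) hb
  refine h.not_of_forall_mem ?_ g hg
  intro v
  simp only [Set.mem_compl_iff, Set.mem_insert_iff, Set.mem_singleton_iff]
  tauto

/-- If a vertex `v` of degree three has three neighbors of degree two, one of which is followed by a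
vertex of degree at most five, then another one does not lie on a thread from `v` with two inner
vertices whose other end has degree at most five. -/
theorem not_thread (h : IsCriticalTwoTone G P) {v x x' a y y' z z' : V} (hv : G.degree v = 3)
    (hx : G.degree x = 2) (hx' : G.degree x' = 2) (hy : G.degree y = 2) (hz : G.degree z = 2)
    (hvx : G.Adj v x) (hxx' : G.Adj x x') (hx'a : G.Adj x' a) (hvx' : x' ≠ v) (hxa : a ≠ x)
    (hvy : G.Adj v y) (hyy' : G.Adj y y') (hvy' : y' ≠ v)
    (hvz : G.Adj v z) (hzz' : G.Adj z z') (hvz' : z' ≠ v)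
    (hxy : x ≠ y) (hxz : x ≠ z) (hyz : y ≠ z) (ha : G.degree a ≤ 5)
    (hdz' : G.degree z' ≤ 5) : False := by
  have hP := h.card
  have h10 := h.ten_le
  obtain ⟨x₀, hx₀, hNx⟩ := exists_adj_iff_of_degree_eq_two hx hvx.symm
  obtain rfl : x' = x₀ := by have := (hNx x').1 hxx'; grind
  obtain ⟨y₀, hy₀, hNy⟩ := exists_adj_iff_of_degree_eq_two hy hvy.symm
  obtain rfl : y' = y₀ := by have := (hNy y').1 hyy'; grind
  obtain ⟨z₀, hz₀, hNz⟩ := exists_adj_iff_of_degree_eq_two hz hvz.symm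
  obtain rfl : z' = z₀ := by have := (hNz z').1 hzz'; grind
  obtain ⟨a₀, ha₀, hNx'⟩ := exists_adj_iff_of_degree_eq_two hx' hxx'.symm
  obtain rfl : a = a₀ := by have := (hNx' a).1 hx'a; grind
  obtain ⟨z₀, hzx, hzy, hNv⟩ := exists_adj_iff_of_degree_eq_three hv hvx hvy hxy
  obtain rfl : z = z₀ := by have := (hNv z).1 hvz; grind
  have hvx₁ := hvx.ne
  have hvy₁ := hvy.ne
  have hvz₁ := hvz.ne
  have hxx₁ := hxx'.ne
  have hyy₁ := hyy'.ne
  have hzz₁ := hzz'.ne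
  have hax := hx'a.ne
  have hx'v : ¬ G.Adj v x' := fun e => h.not_triangle hv hx hx' hvx e hxx'
  have hxny : ¬ G.Adj x y := h.not_triangle hv hx hy hvx hvy
  have hxnz : ¬ G.Adj x z := h.not_triangle hv hx hz hvx hvz
  have hynz : ¬ G.Adj y z := h.not_triangle hv hy hz hvy hvz
  have hx'y : ¬ G.Adj x' y := fun e => by
    have := h.six_le_degree_of_thread hy hx' hx e hxx'.symm hxy.symm hvx.symm hvx'.symm
    omega
  have hx'z : ¬ G.Adj x' z := fun e => by
    have := h.six_le_degree_of_thread hz hx' hx e hxx'.symm hxz.symm hvx.symm hvx'.symm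
    omega
  have hne : x' ≠ y ∧ x' ≠ z ∧ y' ≠ x ∧ y' ≠ x' ∧ y' ≠ z ∧ z' ≠ x ∧ z' ≠ x' ∧ z' ≠ y ∧
      a ≠ v ∧ a ≠ y ∧ a ≠ z := by
    refine ⟨?_, ?_, ?_, ?_, ?_, ?_, ?_, ?_, ?_, ?_, ?_⟩ <;> rintro rfl
    exacts [hx'v hvy, hx'v hvz, hxny hyy'.symm, hx'y hyy'.symm, hynz hyy', hxnz hzz'.symm,
      hx'z hzz'.symm, hynz hzz'.symm, hx'v hx'a.symm, hx'y hx'a, hx'z hx'a]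
  obtain ⟨h1, h2, h3, h4, h5, h6, h7, h8, h9, h11, h12⟩ := hne
  obtain ⟨f, hf⟩ := h.exists_compl {v, x, x', y, z} ⟨x, by simp⟩ (by
    intro s hs n hn m hm hsn hsm
    simp only [Set.mem_insert_iff, Set.mem_singleton_iff] at hs hn hm
    grind)
  obtain ⟨g, hg⟩ := hf.insert_pendant (u := y) (a := y') (by simp) (by simp; grind) hyy'
    (by simp only [Set.mem_compl_iff, Set.mem_insert_iff, Set.mem_singleton_iff]; grind) ∅
    (by simp only [Set.mem_compl_iff, Set.mem_insert_iff, Set.mem_singleton_iff]; grind)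
    (by simpa using h.degree_le y')
  obtain ⟨g, hg⟩ := hg.insert_pendant (u := z) (a := z') (by simp; grind) (by simp; grind) hzz'
    (by simp only [Set.mem_compl_iff, Set.mem_insert_iff, Set.mem_singleton_iff]; grind) {y}
    (by
      simp only [Set.mem_compl_iff, Set.mem_insert_iff, Set.mem_singleton_iff,
        Finset.mem_singleton]
      grind)
    (by rw [Finset.card_singleton]; omega)
  obtain ⟨g, hg⟩ := hg.insert_between (u := v) (p := y) (q := z) hP (by simp; grind) (by simp)
    (by simp)
    (by simp only [Set.mem_compl_iff, Set.mem_insert_iff, Set.mem_singleton_iff]; grind) {y', z'}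
    (by
      simp only [Set.mem_compl_iff, Set.mem_insert_iff, Set.mem_singleton_iff,
        Finset.mem_singleton, Finset.mem_insert]
      grind)
    Finset.card_le_two
  obtain ⟨g, hg⟩ := hg.insert_path (v := v) (x := x) (y := x') (a := a) hP (by simp)
    (by simp; grind) (by simp; grind) (by simp; grind) hxx₁ hNx hNx' (by omega) ha
  refine h.not_of_forall_mem ?_ g hg
  intro v
  simp only [Set.mem_compl_iff, Set.mem_insert_iff, Set.mem_singleton_iff]
  tauto

end IsCriticalTwoTone

section Discharging

variable {V : Type*} [Fintype V] (G : SimpleGraph V) [DecidableRel G.Adj]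

/-- `u` has a neighbor of degree at least six besides `p`. -/
def HasHighBeyond (p u : V) : Prop :=
  ∃ q, q ≠ p ∧ G.Adj u q ∧ 6 ≤ G.degree q

/-- `u` has a neighbor of degree two besides `p`, whose neighbors other than `u` have degree at most
five. -/
def HasLowThreadBeyond (p u : V) : Prop :=
  ∃ q, q ≠ p ∧ G.Adj u q ∧ G.degree q = 2 ∧ ∀ r, r ≠ u → G.Adj q r → G.degree r ≤ 5

open Classical in
/-- The charge sent from `p` to `u`: vertices of degree at least six send 3 along every edge,
vertices of degree two pass on 1 of it, and the others serve the threads ending at them. -/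
noncomputable def chargeFlow (p u : V) : ℤ :=
  if ¬ G.Adj p u then 0
  else if 6 ≤ G.degree p then 3
  else if G.degree p = 2 then if HasHighBeyond G u p then 1 else 0
  else if G.degree u = 2 then
    if HasHighBeyond G p u then 0 else if HasLowThreadBeyond G p u then 2 else 1
  else 0

variable {G}

theorem chargeFlow_nonneg (p u : V) : 0 ≤ chargeFlow G p u := by
  unfold chargeFlow
  split_ifs <;> norm_num

theorem chargeFlow_eq_zero {p u : V} (h : ¬ G.Adj p u) : chargeFlow G p u = 0 := by
  simp [chargeFlow, h]

theorem sum_chargeFlow_left (v : V) :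
    ∑ u, chargeFlow G v u = ∑ u ∈ G.neighborFinset v, chargeFlow G v u :=
  (Finset.sum_subset (Finset.subset_univ _) fun u _ hu =>
    chargeFlow_eq_zero (by simpa using hu)).symm

theorem sum_chargeFlow_right (v : V) :
    ∑ u, chargeFlow G u v = ∑ u ∈ G.neighborFinset v, chargeFlow G u v :=
  (Finset.sum_subset (Finset.subset_univ _) fun u _ hu =>
    chargeFlow_eq_zero (by simpa [G.adj_comm] using hu)).symm

theorem chargeFlow_of_six_le {p u : V} (h : G.Adj p u) (hp : 6 ≤ G.degree p) :
    chargeFlow G p u = 3 := by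
  simp [chargeFlow, h, hp]

theorem chargeFlow_le_two {p u : V} (hp : G.degree p ≤ 5) : chargeFlow G p u ≤ 2 := by
  have : ¬ 6 ≤ G.degree p := by omega
  simp only [chargeFlow, this, if_false]
  split_ifs <;> norm_num

theorem one_le_chargeFlow {p u : V} (hp : G.degree p = 3) (h : 1 ≤ chargeFlow G p u) :
    G.Adj p u ∧ G.degree u = 2 ∧ ∀ q, q ≠ p → G.Adj u q → G.degree q ≤ 5 := by
  unfold chargeFlow at h
  grind [HasHighBeyond, HasLowThreadBeyond]

theorem two_le_chargeFlow {p u : V} (hp : G.degree p = 3) (h : 2 ≤ chargeFlow G p u) :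
    ∃ q, q ≠ p ∧ G.Adj u q ∧ G.degree q = 2 ∧ ∀ r, r ≠ u → G.Adj q r → G.degree r ≤ 5 := by
  unfold chargeFlow at h
  grind [HasHighBeyond, HasLowThreadBeyond]

end Discharging

namespace IsCriticalTwoTone

variable {V : Type*} [Fintype V] [DecidableEq V] {G : SimpleGraph V} [DecidableRel G.Adj]
  {P : Finset ℕ}

theorem sum_chargeFlow_of_degree_eq_two (h : IsCriticalTwoTone G P) {v : V}
    (hv : G.degree v = 2) :
    2 + ∑ u, chargeFlow G v u ≤ ∑ u, chargeFlow G u v := by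
  obtain ⟨p, hp⟩ := (G.degree_pos_iff_exists_adj v).1 (by omega)
  obtain ⟨q, hqp, hNv⟩ := exists_adj_iff_of_degree_eq_two hv hp
  have hq := (hNv q).2 (Or.inr rfl)
  have hN : G.neighborFinset v = {p, q} := by ext n; simp [hNv]
  rw [sum_chargeFlow_left, sum_chargeFlow_right, hN, Finset.sum_pair hqp.symm,
    Finset.sum_pair hqp.symm]
  have hthread := fun b => h.six_le_degree_of_thread (x := p) (y := v) (z := q) (b := b)
  have hthread' := fun b => h.six_le_degree_of_thread (x := q) (y := v) (z := p) (b := b)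
  have h2p := h.two_le_degree p
  have h2q := h.two_le_degree q
  have hp0 := chargeFlow_nonneg (G := G) p v
  have hq0 := chargeFlow_nonneg (G := G) q v
  have hout : ∀ s t, s ≠ t → (∀ n, G.Adj v n ↔ n = s ∨ n = t) →
      chargeFlow G v s = if 6 ≤ G.degree t then 1 else 0 := by
    intro s t hst hN
    unfold chargeFlow
    grind [HasHighBeyond]
  rw [hout p q hqp.symm hNv, hout q p hqp (fun n => by rw [hNv, or_comm])]
  by_cases hp6 : 6 ≤ G.degree p
  · rw [chargeFlow_of_six_le hp.symm hp6]
    split_ifs with hq6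
    · rw [chargeFlow_of_six_le hq.symm hq6]; norm_num
    · omega
  by_cases hq6 : 6 ≤ G.degree q
  · rw [chargeFlow_of_six_le hq.symm hq6]
    simp only [hp6, hq6, if_true, if_false]
    omega
  simp only [hp6, hq6, if_false]
  by_cases hp2 : G.degree p = 2
  · obtain ⟨p', hp', hNp⟩ := exists_adj_iff_of_degree_eq_two hp2 hp.symm
    by_cases hq2 : G.degree q = 2
    · obtain ⟨q', hq', hNq⟩ := exists_adj_iff_of_degree_eq_two hq2 hq.symm
      have e1 := hthread q' hp2 hv hq2 hp hq hqp.symm ((hNq q').2 (Or.inr rfl)) hq'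
      have e2 := hthread' p' hq2 hv hp2 hq hp hqp ((hNp p').2 (Or.inr rfl)) hp'
      have f1 : chargeFlow G p v = 1 := by
        unfold chargeFlow; grind [HasHighBeyond, HasLowThreadBeyond, G.adj_comm]
      have f2 : chargeFlow G q v = 1 := by
        unfold chargeFlow; grind [HasHighBeyond, HasLowThreadBeyond, G.adj_comm]
      omega
    · by_cases hp'6 : 6 ≤ G.degree p'
      · have f1 : chargeFlow G p v = 1 := by
          unfold chargeFlow; grind [HasHighBeyond, HasLowThreadBeyond, G.adj_comm]
        have f2 : 1 ≤ chargeFlow G q v := by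
          unfold chargeFlow; grind [HasHighBeyond, HasLowThreadBeyond, G.adj_comm]
        omega
      · have f2 : 2 ≤ chargeFlow G q v := by
          unfold chargeFlow; grind [HasHighBeyond, HasLowThreadBeyond, G.adj_comm]
        omega
  · by_cases hq2 : G.degree q = 2
    · obtain ⟨q', hq', hNq⟩ := exists_adj_iff_of_degree_eq_two hq2 hq.symm
      by_cases hq'6 : 6 ≤ G.degree q'
      · have f1 : chargeFlow G q v = 1 := by
          unfold chargeFlow; grind [HasHighBeyond, HasLowThreadBeyond, G.adj_comm]
        have f2 : 1 ≤ chargeFlow G p v := by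
          unfold chargeFlow; grind [HasHighBeyond, HasLowThreadBeyond, G.adj_comm]
        omega
      · have f2 : 2 ≤ chargeFlow G p v := by
          unfold chargeFlow; grind [HasHighBeyond, HasLowThreadBeyond, G.adj_comm]
        omega
    · have f1 : 1 ≤ chargeFlow G q v := by
        unfold chargeFlow; grind [HasHighBeyond, HasLowThreadBeyond, G.adj_comm]
      have f2 : 1 ≤ chargeFlow G p v := by
        unfold chargeFlow; grind [HasHighBeyond, HasLowThreadBeyond, G.adj_comm]
      omega

/-- A vertex of degree three does not send more than 3. -/
theorem not_four_le_chargeFlow (h : IsCriticalTwoTone G P) {v x y z : V} (hv : G.degree v = 3)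
    (hxy : x ≠ y) (hxz : x ≠ z) (hyz : y ≠ z) (hx : 2 ≤ chargeFlow G v x)
    (hyzf : 2 ≤ chargeFlow G v y ∨ 1 ≤ chargeFlow G v y ∧ 1 ≤ chargeFlow G v z) : False := by
  have hother : ∀ {u}, G.Adj v u → G.degree u = 2 → ∃ u', u' ≠ v ∧ G.Adj u u' :=
    fun hvu hu => by
      obtain ⟨u', hu', hN⟩ := exists_adj_iff_of_degree_eq_two hu hvu.symm
      exact ⟨u', hu', (hN u').2 (Or.inr rfl)⟩
  obtain ⟨hvx, hdx, -⟩ := one_le_chargeFlow hv (by omega : 1 ≤ chargeFlow G v x)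
  obtain ⟨x', hx'v, hxx', hdx', hx'5⟩ := two_le_chargeFlow hv hx
  obtain ⟨a, ha, hNx'⟩ := exists_adj_iff_of_degree_eq_two hdx' hxx'.symm
  have hx'a := (hNx' a).2 (Or.inr rfl)
  rcases hyzf with hy | ⟨hy, hz⟩
  · obtain ⟨hvy, hdy, -⟩ := one_le_chargeFlow hv (by omega : 1 ≤ chargeFlow G v y)
    obtain ⟨y', hy'v, hyy', hdy', hy'5⟩ := two_le_chargeFlow hv hy
    obtain ⟨b, hb, hNy'⟩ := exists_adj_iff_of_degree_eq_two hdy' hyy'.symm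
    have hy'b := (hNy' b).2 (Or.inr rfl)
    exact h.not_two_threads hv hdx hdx' hdy hdy' hvx hxx' hx'a hx'v ha hvy hyy' hy'b hy'v hb hxy
      (hx'5 a ha hx'a) (hy'5 b hb hy'b)
  · obtain ⟨hvy, hdy, -⟩ := one_le_chargeFlow hv hy
    obtain ⟨hvz, hdz, hz5⟩ := one_le_chargeFlow hv hz
    obtain ⟨y', hy', hyy'⟩ := hother hvy hdy
    obtain ⟨z', hz', hzz'⟩ := hother hvz hdz
    exact h.not_thread hv hdx hdx' hdy hdz hvx hxx' hx'a hx'v ha hvy hyy' hy' hvz hzz' hz' hxy hxz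
      hyz (hx'5 a ha hx'a) (hz5 z' hz' hzz')

theorem sum_chargeFlow_of_degree_eq_three (h : IsCriticalTwoTone G P) {v : V}
    (hv : G.degree v = 3) : ∑ u, chargeFlow G v u ≤ 3 := by
  obtain ⟨x, y, z, hxy, hxz, hyz, hN⟩ :=
    Finset.card_eq_three.1 (by rw [G.card_neighborFinset_eq_degree, hv])
  rw [sum_chargeFlow_left, hN, Finset.sum_insert (by simp [hxy, hxz]), Finset.sum_pair hyz]
  have h2 : ∀ u, chargeFlow G v u ≤ 2 := fun u => chargeFlow_le_two (by omega)
  have hx := h2 x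
  have hy := h2 y
  have hz := h2 z
  by_contra! hlt
  have c1 := h.not_four_le_chargeFlow hv hxy hxz hyz
  have c2 := h.not_four_le_chargeFlow hv hyz hxy.symm hxz.symm
  have c3 := h.not_four_le_chargeFlow hv hxz.symm hyz.symm hxy
  grind

theorem twelve_le_charge (h : IsCriticalTwoTone G P) (v : V) :
    12 + ∑ u, chargeFlow G v u ≤ 5 * (G.degree v : ℤ) + ∑ u, chargeFlow G u v := by
  have h0 : 0 ≤ ∑ u, chargeFlow G u v := Finset.sum_nonneg fun u _ => chargeFlow_nonneg u v
  have h2 := h.two_le_degree v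
  rcases (by omega : G.degree v = 2 ∨ G.degree v = 3 ∨ (4 ≤ G.degree v ∧ G.degree v ≤ 5) ∨
    6 ≤ G.degree v) with hv | hv | hv | hv
  · have := h.sum_chargeFlow_of_degree_eq_two hv
    omega
  · have := h.sum_chargeFlow_of_degree_eq_three hv
    omega
  · have : ∑ u, chargeFlow G v u ≤ G.degree v * 2 := by
      rw [sum_chargeFlow_left, ← G.card_neighborFinset_eq_degree, ← nsmul_eq_mul]
      exact Finset.sum_le_card_nsmul _ _ _ fun u _ => chargeFlow_le_two hv.2
    omega
  · have : ∑ u, chargeFlow G v u = G.degree v * 3 := by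
      rw [sum_chargeFlow_left, ← G.card_neighborFinset_eq_degree, ← nsmul_eq_mul]
      exact Finset.sum_eq_card_nsmul fun u hu =>
        chargeFlow_of_six_le (by simpa using hu) hv
    omega

theorem twelve_mul_card_le (h : IsCriticalTwoTone G P) :
    12 * Fintype.card V ≤ 5 * ∑ v, G.degree v := by
  have h1 := Finset.sum_le_sum fun v (_ : v ∈ Finset.univ) => h.twelve_le_charge v
  rw [Finset.sum_add_distrib, Finset.sum_add_distrib, Finset.sum_comm (f := fun v u =>
    chargeFlow G u v), ← Finset.mul_sum, Finset.sum_const, Finset.card_univ, nsmul_eq_mul] at h1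
  zify
  linarith

end IsCriticalTwoTone

theorem exists_twoTone_of_sparse {P : Finset ℕ} (hP : 7 ≤ P.card) (n : ℕ) {V : Type*} [Fintype V]
    [DecidableEq V] (G : SimpleGraph V) [DecidableRel G.Adj] (hn : Fintype.card V = n)
    (hdeg : ∀ v, G.degree v ≤ (P.card - 2).choose 2)
    (hsparse : ∀ S : Finset V, S.Nonempty →
      5 * ∑ v ∈ S, (S.filter (G.Adj v)).card < 12 * S.card) :
    ∃ f, IsPartialTwoTone G P Set.univ f := by
  induction n using Nat.strong_induction_on generalizing V with
  | _ n ih =>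
  by_contra! hno
  have hcrit : IsCriticalTwoTone G P := by
    refine ⟨hP, hdeg, hno, fun S hS hout => ?_⟩
    classical
    obtain ⟨f, hf⟩ := ih (Fintype.card (Sᶜ : Set V)) (by
        rw [← hn]
        obtain ⟨s, hs⟩ := hS
        exact Fintype.card_subtype_lt (x := s) (by simpa using hs)) (G.induce Sᶜ) rfl
      (fun v => by
        refine le_trans ?_ (hdeg v)
        rw [← card_neighborFinset_eq_degree, ← card_neighborFinset_eq_degree]
        exact Finset.card_le_card_of_injOn Subtype.val (fun w hw => by simpa using hw)
          Subtype.val_injective.injOn)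
      (fun T hT => by
        have := hsparse (T.map (Function.Embedding.subtype _)) (hT.map)
        simp only [Finset.sum_map, Finset.filter_map, Finset.card_map] at this
        convert this
        rfl)
    refine ⟨fun v => if hv : v ∈ Sᶜ then f ⟨v, hv⟩ else ∅, ?_, ?_, ?_⟩
    · intro v hv
      simp only [hv, dif_pos]
      exact hf.mem _ trivial
    · intro v hv w hw hvw
      simp only [hv, hw, dif_pos]
      exact hf.disjoint _ trivial _ trivial (by simpa using hvw)
    · intro v hv w hw hvw u huv huw
      simp only [hv, hw, dif_pos]
      by_cases hu : u ∈ S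
      · exact (hvw (hout u hu v hv w hw huv huw)).elim
      · exact hf.ne _ trivial _ trivial (by simpa using hvw) ⟨u, hu⟩ (by simpa using huv)
          (by simpa using huw)
  have h1 := hcrit.twelve_mul_card_le
  have hne : (Finset.univ : Finset V).Nonempty := by
    rw [Finset.univ_nonempty_iff]
    by_contra hV
    rw [not_nonempty_iff] at hV
    exact hno (fun _ => ∅) ⟨fun v => hV.elim v, fun v => hV.elim v, fun v => hV.elim v⟩
  have h2 := hsparse Finset.univ hne
  simp only [← G.neighborFinset_eq_filter, G.card_neighborFinset_eq_degree,
    Finset.card_univ] at h2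
  omega

theorem isTToneColoring_two_s2 {V : Type*} {G : SimpleGraph V} {k : ℕ} {f : V → Finset ℕ}
    (hf : IsPartialTwoTone G (Finset.Icc 1 k) Set.univ f) : IsTToneColoring G 2 k f := by
  refine ⟨fun v => hf.subset trivial, fun v => hf.card trivial, fun v w hvw => ?_⟩
  by_contra! hle
  have h2 : (f v ∩ f w).card ≤ 2 :=
    (Finset.card_le_card Finset.inter_subset_left).trans (hf.card trivial).le
  have hne : G.edist v w ≠ ⊤ := fun e => by simp [e] at hle
  obtain ⟨p, hp⟩ := exists_walk_of_edist_ne_top hne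
  rw [← hp, Nat.cast_le] at hle
  match p with
  | .nil => exact hvw rfl
  | .cons h .nil =>
    have := Finset.disjoint_iff_inter_eq_empty.1 (hf.disjoint _ trivial _ trivial h)
    simp [this] at hle
  | .cons h (.cons h' q) =>
    simp only [Walk.length_cons] at hle
    cases q with
    | nil =>
      refine hf.ne v trivial w trivial hvw _ h.symm h' ?_
      have hi : f v ∩ f w = f v := Finset.eq_of_subset_of_card_le Finset.inter_subset_left (by
        rw [hf.card trivial]; omega)
      exact Finset.eq_of_subset_of_card_le (Finset.inter_eq_left.1 hi) (by
        rw [hf.card trivial, hf.card trivial])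
    | cons h'' q => simp only [Walk.length_cons] at hle; omega

theorem MadLT.sum_card_filter_lt {V : Type*} [Fintype V] [DecidableEq V] {G : SimpleGraph V}
    [DecidableRel G.Adj] {q : ℚ} (hG : MadLT G q) {S : Finset V} (hS : S.Nonempty) :
    ((∑ v ∈ S, (S.filter (G.Adj v)).card : ℕ) : ℚ) < q * S.card := by
  classical
  let H : SimpleGraph V :=
    { Adj := fun v w => G.Adj v w ∧ v ∈ S ∧ w ∈ S
      symm := ⟨fun v w h => ⟨h.1.symm, h.2.2, h.2.1⟩⟩
      loopless := ⟨fun v h => G.loopless.irrefl v h.1⟩ }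
  have hset : {e ∈ G.edgeSet | ∀ v ∈ e, v ∈ S} = (H.edgeFinset : Set (Sym2 V)) := by
    ext e
    induction e with
    | _ v w => simp [H]
  have hdeg : ∀ v, H.degree v = if v ∈ S then (S.filter (G.Adj v)).card else 0 := by
    intro v
    rw [← H.card_neighborFinset_eq_degree]
    split_ifs with hv
    · congr 1
      ext w
      simp [H, hv, and_comm]
    · rw [Finset.card_eq_zero]
      ext w
      simp [H, hv]
  have hsum := H.sum_degrees_eq_twice_card_edges
  simp only [hdeg, Finset.sum_ite_mem, Finset.univ_inter] at hsum
  have h := hG S hS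
  rw [hset, Set.ncard_coe_finset, div_lt_iff₀ (by exact_mod_cast hS.card_pos)] at h
  rw [hsum]
  exact_mod_cast h

theorem le_choose_two_of_sqrt_le {d k : ℕ} (hk : 7 ≤ k)
    (h : Real.sqrt (2 * (d : ℝ) + 0.25) + 2.5 ≤ k) : d ≤ (k - 2).choose 2 := by
  obtain ⟨m, rfl⟩ := Nat.exists_eq_add_of_le hk
  have h1 : Real.sqrt (2 * (d : ℝ) + 0.25) ≤ m + 4.5 := by
    push_cast at h
    linarith
  rw [Real.sqrt_le_left (by positivity)] at h1
  have h2 : 2 * d ≤ (m + 5) * (m + 4) := by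
    have : (2 * d : ℝ) ≤ (m + 5) * (m + 4) := by nlinarith
    exact_mod_cast this
  rw [Nat.choose_two_right, Nat.le_div_iff_mul_le two_pos]
  have e1 : 7 + m - 2 = m + 5 := by omega
  rw [e1]
  simpa [mul_comm] using h2

/-- If `mad(G) < 12/5`, then `τ₂(G) ≤ max {7, ⌈√(2Δ(G)+0.25) + 2.5⌉}`. -/
theorem two_tone_mad {V : Type*} [Fintype V] (G : SimpleGraph V) (hG : MadLT G (12/5)) :
    toneChromaticNumber G 2 ≤
      max 7 ⌈Real.sqrt (2 * (maxDeg G : ℝ) + 0.25) + 2.5⌉₊ := by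
  classical
  set k := max 7 ⌈Real.sqrt (2 * (maxDeg G : ℝ) + 0.25) + 2.5⌉₊
  have hk : 7 ≤ k := le_max_left _ _
  have hmax : maxDeg G ≤ (k - 2).choose 2 := le_choose_two_of_sqrt_le hk
    ((Nat.le_ceil _).trans (Nat.cast_le.2 (le_max_right _ _)))
  obtain ⟨f, hf⟩ := exists_twoTone_of_sparse (P := Finset.Icc 1 k) (by simpa using hk) _ G rfl
    (fun v => by
      rw [Nat.card_Icc, Nat.add_sub_cancel]
      refine le_trans ?_ hmax
      have := Finset.le_sup (f := fun v => (G.neighborSet v).ncard) (Finset.mem_univ v)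
      rwa [← G.coe_neighborFinset, Set.ncard_coe_finset, G.card_neighborFinset_eq_degree] at this)
    (fun S hS => by
      have h := hG.sum_card_filter_lt hS
      have : (5 * (∑ v ∈ S, (S.filter (G.Adj v)).card : ℕ) : ℚ) < 12 * S.card := by linarith
      exact_mod_cast this)
  exact Nat.sInf_le ⟨f, isTToneColoring_two_s2 hf⟩
end
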